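/- arXiv:2101.00856 — 2 statements merged into one kernel-verified Lean document; each statement's English description precedes it below -/
import Mathlib

section
/- Let $(M,g)$ be a smooth four-dimensional Lorentzian spacetime of signature $(+,-,-,-)$ with spinor structure, Levi-Civita connection $\nabla_a=\nabla_{AA'}$ (extended to spinors by $\nabla_{AA'}\epsilon_{BC}=0$) and Weyl spinor $\Psi_{ABCD}$; indices are lowered by $\psi_B=\psi^A\epsilon_{AB}$. Let $(o^A,\iota^A)$ be a smooth spin dyad on $M$ with $o_A\iota^A=1$, and let $l^a=o^A\bar o^{A'}$, $n^a=\iota^A\bar\iota^{A'}$, $m^a=o^A\bar\iota^{A'}$, $\bar m^a=\iota^A\bar o^{A'}$. Let the spin coefficients be $$\rho=o^A\bar m^b\nabla_b o_A,\quad \tau=o^A n^b\nabla_b o_A,\quad \epsilon=\iota^A l^b\nabla_b o_A,\quad \beta=\iota^A m^b\nabla_b o_A,$$ $$\rho'=-\iota^A m^b\nabla_b\iota_A,\quad \tau'=-\iota^A l^b\nabla_b\iota_A,\quad \epsilon'=-o^A n^b\nabla_b\iota_A,\quad \beta'=-o^A\bar m^b\nabla_b\iota_A,$$ and put $f_a=\rho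 n_a+\rho' l_a-\tau' m_a-\tau\bar m_a$, $\omega_a=-\epsilon n_a+\epsilon' l_a-\beta' m_a+\beta\bar m_a$, $B_a=-\rho n_a+\tau\bar m_a$. For a scalar field $h$ of GHP weight $\{p,0\}$ and conformal weight $w$ (represented by its values in the gauge given by the dyad and the metric) let $\mathcal C_{AA'}h=\nabla_{AA'}h+\bigl(wf_{AA'}+p(\omega_{AA'}+B_{AA'})\bigr)h$ and $\tilde{\mathcal C}_{A'}h=o^A\mathcal C_{AA'}h$. Suppose that $o^A$ is a shear-free ray, $o^Ao^B\nabla_{AA'}o_B=0$, and a repeated principal spinor, $\Psi_{ABCD}o^Bo^Co^D=0$, and that there are smooth complex scalar fields $\phi$, nowhere zero, of GHP weight $\{0,0\}$ and conformal weight $-1$, and $\eta$, of GHP weight $\{-2,0\}$ and conformal weight $-1$, such that $$f_{AA'}=\nabla_{AA'}\log\phi-o_A\tilde{\mathcal C}_{A'}\eta,\qquad\text{where }\nabla_{AA'}\log\phi:=\phi^{-1}\nabla_{AA'}\phi .$$ Then the spinor field $K_{AB}=\phi^{-1}\bigl[o_{(A}\iota_{B)}-\eta\,o_Ao_B\bigr]$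 satisfies the projected Killing spinor equation $$o^A\nabla_{A'(A}K_{BC)}=0 .$$ -/
open scoped Manifold ContDiff Bundle

noncomputable section

namespace SpinGeometry

/-! ### Lorentzian metrics and the Levi-Civita connection -/

/-- The Minkowski matrix `diag(1, -1, -1, -1)`. -/
def minkowski (i j : Fin 4) : ℝ := if i = j then (if i = 0 then 1 else -1) else 0

/-- A smooth Lorentzian metric, of signature `(+,-,-,-)`, on a 4-manifold. -/
structure LorentzianMetric (M : Type*) [TopologicalSpace M]
    [ChartedSpace (EuclideanSpace ℝ (Fin 4)) M] [IsManifold (𝓡 4) ∞ M] where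
  inner (x : M) : TangentSpace (𝓡 4) x →L[ℝ] TangentSpace (𝓡 4) x →L[ℝ] ℝ
  symm (x : M) (v w : TangentSpace (𝓡 4) x) : inner x v w = inner x w v
  signature (x : M) : ∃ b : Module.Basis (Fin 4) ℝ (TangentSpace (𝓡 4) x),
    ∀ i j, inner x (b i) (b j) = minkowski i j
  contMDiff : ContMDiff (𝓡 4)
    ((𝓡 4).prod 𝓘(ℝ, EuclideanSpace ℝ (Fin 4) →L[ℝ] EuclideanSpace ℝ (Fin 4) →L[ℝ] ℝ)) ∞
    (fun x ↦ Bundle.TotalSpace.mk'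
      (EuclideanSpace ℝ (Fin 4) →L[ℝ] EuclideanSpace ℝ (Fin 4) →L[ℝ] ℝ) x (inner x))

variable {M : Type*} [TopologicalSpace M] [ChartedSpace (EuclideanSpace ℝ (Fin 4)) M]
  [IsManifold (𝓡 4) ∞ M]

/-- The scalar `g(∇_X Y, Z)`, where `∇` is the Levi-Civita connection of `g`, given by the
Koszul formula. -/
def koszul (g : LorentzianMetric M) (X Y Z : (x : M) → TangentSpace (𝓡 4) x) (x : M) : ℝ :=
  (1 / 2 : ℝ) *
    (mvfderiv (𝓡 4) (fun y ↦ g.inner y (Y y) (Z y)) x (X x)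
      + mvfderiv (𝓡 4) (fun y ↦ g.inner y (Z y) (X y)) x (Y x)
      - mvfderiv (𝓡 4) (fun y ↦ g.inner y (X y) (Y y)) x (Z x)
      + g.inner x (VectorField.mlieBracket (𝓡 4) X Y x) (Z x)
      - g.inner x (VectorField.mlieBracket (𝓡 4) Y Z x) (X x)
      + g.inner x (VectorField.mlieBracket (𝓡 4) Z X x) (Y x))

/-- A spin frame of `(M, g)`, that is a trivialization of the spin bundle `𝕊` compatible with its
symplectic form; it is given through the smooth orthonormal frame of `TM` that it induces (and
that determines it up to a global sign on each component of `M`, under which nothing below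
changes).  A spin dyad defined on all of `M` is such a trivialization, so on a spacetime that
carries a dyad a spin frame always exists.

Relative to a spin frame a spinor field has components indexed by `A : Fin 2`, and a primed
spinor field has components, relative to the conjugate frame, indexed by `A' : Fin 2`. -/
structure SpinFrame (g : LorentzianMetric M) where
  e (i : Fin 4) (x : M) : TangentSpace (𝓡 4) x
  contMDiff (i : Fin 4) : ContMDiff (𝓡 4) (𝓡 4).tangent ∞
    (fun x ↦ (⟨x, e i x⟩ : TangentBundle (𝓡 4) M))
  orthonormal (i j : Fin 4) (x : M) : g.inner x (e i x) (e j x) = minkowski i j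

variable {g : LorentzianMetric M}

/-- The Levi-Civita covariant derivative `∇_X Y`, expanded in the orthonormal frame. -/
def SpinFrame.leviCivita (F : SpinFrame g) (X Y : (x : M) → TangentSpace (𝓡 4) x) (x : M) :
    TangentSpace (𝓡 4) x :=
  ∑ k, (minkowski k k * koszul g X Y (F.e k) x) • F.e k x

/-- The Riemann curvature `∇_X ∇_Y Z - ∇_Y ∇_X Z - ∇_[X,Y] Z`. -/
def SpinFrame.curvature (F : SpinFrame g) (X Y Z : (x : M) → TangentSpace (𝓡 4) x) (x : M) :
    TangentSpace (𝓡 4) x :=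
  F.leviCivita X (F.leviCivita Y Z) x - F.leviCivita Y (F.leviCivita X Z) x
    - F.leviCivita (VectorField.mlieBracket (𝓡 4) X Y) Z x

/-- The frame components `R_{ijkl}` of the Riemann tensor, with the convention
`(∇_a ∇_b - ∇_b ∇_a) V^d = R_{abc}{}^d V^c`. -/
def SpinFrame.riemann (F : SpinFrame g) (i j k l : Fin 4) (x : M) : ℝ :=
  g.inner x (F.curvature (F.e i) (F.e j) (F.e k) x) (F.e l x)

/-! ### Spinor algebra -/

/-- The components of `ε_{AB}`, which are also those of `ε^{AB}`, `ε_{A'B'}`, `ε^{A'B'}`. -/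
def eps : Matrix (Fin 2) (Fin 2) ℂ := !![0, 1; -1, 0]

/-- Lowering of an index: `ψ_B = ψ^A ε_{AB}`. -/
def lower (ψ : Fin 2 → ℂ) (B : Fin 2) : ℂ := ∑ A, ψ A * eps A B

/-- The components of the complex conjugate spinor. -/
def conjS (ψ : Fin 2 → ℂ) (A' : Fin 2) : ℂ := starRingEnd ℂ (ψ A')

/-- The Infeld-van der Waerden symbols `σ_i{}^{AA'}`: the vector with frame components `v^i`
corresponds to `v^{AA'} = v^i σ_i{}^{AA'}`, and `g_{ab} = ε_{AB} ε_{A'B'}`. -/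
def ivdw : Fin 4 → Matrix (Fin 2) (Fin 2) ℂ :=
  ![((√2 : ℝ) : ℂ)⁻¹ • !![1, 0; 0, 1],
    ((√2 : ℝ) : ℂ)⁻¹ • !![0, 1; 1, 0],
    ((√2 : ℝ) : ℂ)⁻¹ • !![0, Complex.I; -Complex.I, 0],
    ((√2 : ℝ) : ℂ)⁻¹ • !![1, 0; 0, -1]]

/-- The inverse symbols `σ^i{}_{AA'}`, obtained from `σ_i{}^{AA'}` by raising and lowering. -/
def ivdwInv (i : Fin 4) (A A' : Fin 2) : ℂ :=
  ∑ B, ∑ B', (minkowski i i : ℂ) * ivdw i B B' * eps B A * eps B' A'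

/-! ### The covariant derivative of spinor fields and the Weyl spinor -/

/-- `∂_{AA'} h` for a complex scalar field `h`. -/
def SpinFrame.partialS (F : SpinFrame g) (h : M → ℂ) (A A' : Fin 2) (x : M) : ℂ :=
  ∑ i, ivdwInv i A A' * mvfderiv (𝓡 4) h x (F.e i x)

/-- The spin connection `Γ_{AA'C}{}^B` of the Levi-Civita connection: with
`∇_{e_i} e_j = γ^k{}_{ij} e_k`, it is `½ σ^i{}_{AA'} σ_k{}^{BB'} σ^j{}_{CB'} γ^k{}_{ij}`, the unique
trace-free connection for which the symbols `σ_i{}^{AA'}` are covariantly constant. -/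
def SpinFrame.spinConn (F : SpinFrame g) (A A' C B : Fin 2) (x : M) : ℂ :=
  (1 / 2 : ℂ) * ∑ i, ∑ j, ∑ k, ∑ B', ivdwInv i A A' * ivdw k B B' * ivdwInv j C B' *
    ((minkowski k k * koszul g (F.e i) (F.e j) (F.e k) x : ℝ) : ℂ)

/-- `∇_{AA'} ψ_B` for a spinor field with one lower index. -/
def SpinFrame.nabla₁ (F : SpinFrame g) (ψ : M → Fin 2 → ℂ) (A A' B : Fin 2) (x : M) : ℂ :=
  F.partialS (fun y ↦ ψ y B) A A' x - ∑ D, F.spinConn A A' B D x * ψ x D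

/-- `∇_{AA'} K_{BC}` for a spinor field with two lower indices. -/
def SpinFrame.nabla₂ (F : SpinFrame g) (K : M → Fin 2 → Fin 2 → ℂ) (A A' B C : Fin 2) (x : M) :
    ℂ :=
  F.partialS (fun y ↦ K y B C) A A' x - ∑ D, F.spinConn A A' B D x * K x D C
    - ∑ D, F.spinConn A A' C D x * K x B D

/-- The curvature spinor `X_{ABCD} = ¼ R_{abcd} ε^{A'B'} ε^{C'D'}`. -/
def SpinFrame.curvX (F : SpinFrame g) (I : Fin 4 → Fin 2) (x : M) : ℂ :=
  (1 / 4 : ℂ) * ∑ i, ∑ j, ∑ k, ∑ l, ∑ A', ∑ B', ∑ C', ∑ D',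
    (F.riemann i j k l x : ℂ) * ivdwInv i (I 0) A' * ivdwInv j (I 1) B' * ivdwInv k (I 2) C' *
      ivdwInv l (I 3) D' * eps A' B' * eps C' D'

/-- The Weyl spinor `Ψ_{ABCD} = X_{(ABCD)}`. -/
def SpinFrame.weyl (F : SpinFrame g) (A B C D : Fin 2) (x : M) : ℂ :=
  (1 / 24 : ℂ) * ∑ s : Equiv.Perm (Fin 4), F.curvX (fun n ↦ ![A, B, C, D] (s n)) x

/-! ### Dyads, spin coefficients and the conformal-GHP connection -/

/-- A smooth spin dyad `(o^A, ι^A)`, normalized by `o_A ι^A = 1`. -/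
structure SpinDyad (F : SpinFrame g) where
  o : M → Fin 2 → ℂ
  iota : M → Fin 2 → ℂ
  contMDiff_o (A : Fin 2) : ContMDiff (𝓡 4) 𝓘(ℝ, ℂ) ∞ (fun x ↦ o x A)
  contMDiff_iota (A : Fin 2) : ContMDiff (𝓡 4) 𝓘(ℝ, ℂ) ∞ (fun x ↦ iota x A)
  normalized (x : M) : ∑ A, lower (o x) A * iota x A = 1

/-- `o^A` is a shear-free ray: `o^A o^B ∇_{AA'} o_B = 0`. -/
def IsShearFreeRay (F : SpinFrame g) (o : M → Fin 2 → ℂ) : Prop :=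
  ∀ (A' : Fin 2) (x : M),
    ∑ A, ∑ B, o x A * o x B * F.nabla₁ (fun y ↦ lower (o y)) A A' B x = 0

/-- `o^A` is a repeated principal spinor: `Ψ_{ABCD} o^B o^C o^D = 0`. -/
def IsRepeatedPrincipalSpinor (F : SpinFrame g) (o : M → Fin 2 → ℂ) : Prop :=
  ∀ (A : Fin 2) (x : M), ∑ B, ∑ C, ∑ D, F.weyl A B C D x * o x B * o x C * o x D = 0

/-- The scalar `ψ^B α^A μ̄^{A'} ∇_{AA'} χ_B`. -/
def SpinFrame.coeff (F : SpinFrame g) (ψ α μ χ : M → Fin 2 → ℂ) (x : M) : ℂ :=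
  ∑ A, ∑ A', ∑ B, ψ x B * α x A * conjS (μ x) A' * F.nabla₁ (fun y ↦ lower (χ y)) A A' B x

namespace SpinDyad

variable {F : SpinFrame g} (d : SpinDyad F)

/-- `l_a = o_A ō_{A'}`. -/
def l (A A' : Fin 2) (x : M) : ℂ := lower (d.o x) A * lower (conjS (d.o x)) A'

/-- `n_a = ι_A ῑ_{A'}`. -/
def n (A A' : Fin 2) (x : M) : ℂ := lower (d.iota x) A * lower (conjS (d.iota x)) A'

/-- `m_a = o_A ῑ_{A'}`. -/
def m (A A' : Fin 2) (x : M) : ℂ := lower (d.o x) A * lower (conjS (d.iota x)) A'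

/-- `m̄_a = ι_A ō_{A'}`. -/
def mbar (A A' : Fin 2) (x : M) : ℂ := lower (d.iota x) A * lower (conjS (d.o x)) A'

/-! The spin coefficients in the Geroch-Held-Penrose notation.  With `D = l^a ∇_a`,
`δ = m^a ∇_a`, `δ' = m̄^a ∇_a` and `D' = n^a ∇_a`, they are `ρ = o^A δ' o_A`, `τ = o^A D' o_A`,
`ε = ι^A D o_A`, `β = ι^A δ o_A`, and the primed ones result from `o^A ↦ i ι^A`, `ι^A ↦ i o^A`. -/

def rho : M → ℂ := F.coeff d.o d.iota d.o d.o
def tau : M → ℂ := F.coeff d.o d.iota d.iota d.o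
def epsilon : M → ℂ := F.coeff d.iota d.o d.o d.o
def beta : M → ℂ := F.coeff d.iota d.o d.iota d.o
def rho' (x : M) : ℂ := -F.coeff d.iota d.o d.iota d.iota x
def tau' (x : M) : ℂ := -F.coeff d.iota d.o d.o d.iota x
def epsilon' (x : M) : ℂ := -F.coeff d.o d.iota d.iota d.iota x
def beta' (x : M) : ℂ := -F.coeff d.o d.iota d.o d.iota x

/-- `ω_a = -ε n_a + ε' l_a - β' m_a + β m̄_a`. -/
def omega (A A' : Fin 2) (x : M) : ℂ :=
  -d.epsilon x * d.n A A' x + d.epsilon' x * d.l A A' x - d.beta' x * d.m A A' x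
    + d.beta x * d.mbar A A' x

/-- `B_a = -ρ n_a + τ m̄_a`. -/
def formB (A A' : Fin 2) (x : M) : ℂ :=
  -d.rho x * d.n A A' x + d.tau x * d.mbar A A' x

/-- `f_a = ρ n_a + ρ' l_a - τ' m_a - τ m̄_a`. -/
def f (A A' : Fin 2) (x : M) : ℂ :=
  d.rho x * d.n A A' x + d.rho' x * d.l A A' x - d.tau' x * d.m A A' x
    - d.tau x * d.mbar A A' x

/-- The conformal-GHP connection `C_{AA'}` on scalar fields of GHP weight `{p,0}` and conformal
weight `w`: `C_a h = ∇_a h + (w f_a + p (ω_a + B_a)) h`.  A weighted scalar field is represented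
by its value in the gauge fixed by the dyad and the metric. -/
def confGHP (p w : ℤ) (h : M → ℂ) (A A' : Fin 2) (x : M) : ℂ :=
  F.partialS h A A' x + (w * d.f A A' x + p * (d.omega A A' x + d.formB A A' x)) * h x

/-- The projection `C̃_{A'} = o^A C_{AA'}`. -/
def projC (p w : ℤ) (h : M → ℂ) (A' : Fin 2) (x : M) : ℂ :=
  ∑ A, d.o x A * d.confGHP p w h A A' x

/-- `K_{AB} = φ⁻¹ [o_{(A} ι_{B)} - η o_A o_B]`. -/
def killing (φ η : M → ℂ) (x : M) (A B : Fin 2) : ℂ :=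
  (φ x)⁻¹ * ((1 / 2 : ℂ) * (lower (d.o x) A * lower (d.iota x) B
    + lower (d.iota x) A * lower (d.o x) B) - η x * lower (d.o x) A * lower (d.o x) B)

end SpinDyad

/-- The symmetrization `T_{(ABC)}`. -/
def sym₃ (T : Fin 2 → Fin 2 → Fin 2 → ℂ) (A B C : Fin 2) : ℂ :=
  (1 / 6 : ℂ) * (T A B C + T A C B + T B A C + T B C A + T C A B + T C B A)

/-- The projected Killing spinor equation `o^A ∇_{A'(A} K_{BC)} = 0`. -/
def ProjectedKillingSpinorEq (F : SpinFrame g) (o : M → Fin 2 → ℂ)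
    (K : M → Fin 2 → Fin 2 → ℂ) : Prop :=
  ∀ (A' B C : Fin 2) (x : M),
    ∑ A, o x A * sym₃ (fun A B C ↦ F.nabla₂ K A A' B C x) A B C = 0

end SpinGeometry

end

open SpinGeometry

noncomputable section

namespace SpinGeometry

/-! ### Complex functions and spinor fields on a manifold -/

section

variable {M : Type*} [TopologicalSpace M] [ChartedSpace (EuclideanSpace ℝ (Fin 4)) M]

lemma mvfderiv_mul_complex {h k : M → ℂ} {x : M}
    (hh : MDifferentiableAt (𝓡 4) 𝓘(ℝ, ℂ) h x)
    (hk : MDifferentiableAt (𝓡 4) 𝓘(ℝ, ℂ) k x) (v : TangentSpace (𝓡 4) x) :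
    mvfderiv (𝓡 4) (fun y ↦ h y * k y) x v
      = h x * mvfderiv (𝓡 4) k x v + k x * mvfderiv (𝓡 4) h x v := by
  have key := (hh.hasMFDerivAt.mul hk.hasMFDerivAt).mfderiv
  exact congrArg (fun T ↦ T v) key

lemma _root_.MDifferentiableAt.inv_complex {h : M → ℂ} {x : M}
    (hh : MDifferentiableAt (𝓡 4) 𝓘(ℝ, ℂ) h x) (h0 : h x ≠ 0) :
    MDifferentiableAt (𝓡 4) 𝓘(ℝ, ℂ) (fun y ↦ (h y)⁻¹) x :=
  MDifferentiableAt.comp (I' := 𝓘(ℝ, ℂ)) (g := fun z : ℂ ↦ z⁻¹) x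
    (((differentiableAt_inv (𝕜 := ℂ) h0).restrictScalars ℝ).mdifferentiableAt) hh

lemma _root_.MDifferentiableAt.lower {ψ : M → Fin 2 → ℂ} {x : M}
    (hψ : ∀ A, MDifferentiableAt (𝓡 4) 𝓘(ℝ, ℂ) (fun y ↦ ψ y A) x) (B : Fin 2) :
    MDifferentiableAt (𝓡 4) 𝓘(ℝ, ℂ) (fun y ↦ lower (ψ y) B) x := by
  simp only [SpinGeometry.lower, Fin.sum_univ_two]
  exact ((hψ 0).mul mdifferentiableAt_const).add ((hψ 1).mul mdifferentiableAt_const)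

end

variable {M : Type*} [TopologicalSpace M] [ChartedSpace (EuclideanSpace ℝ (Fin 4)) M]
  [IsManifold (𝓡 4) ∞ M] {g : LorentzianMetric M}

/-! ### The derivation `∂_{AA'}` on scalar fields -/

namespace SpinFrame

variable (F : SpinFrame g) {h k : M → ℂ} {x : M} (A A' : Fin 2)

lemma partialS_const (c : ℂ) : F.partialS (fun _ ↦ c) A A' x = 0 := by
  simp [partialS, mvfderiv_const]

lemma partialS_add (hh : MDifferentiableAt (𝓡 4) 𝓘(ℝ, ℂ) h x)
    (hk : MDifferentiableAt (𝓡 4) 𝓘(ℝ, ℂ) k x) :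
    F.partialS (fun y ↦ h y + k y) A A' x = F.partialS h A A' x + F.partialS k A A' x := by
  have key := mvfderiv_add hh hk
  simp only [partialS, ← Finset.sum_add_distrib, ← mul_add]
  refine Finset.sum_congr rfl fun i _ ↦ congrArg _ ?_
  exact congrArg (fun T ↦ T (F.e i x)) key

lemma partialS_mul (hh : MDifferentiableAt (𝓡 4) 𝓘(ℝ, ℂ) h x)
    (hk : MDifferentiableAt (𝓡 4) 𝓘(ℝ, ℂ) k x) :
    F.partialS (fun y ↦ h y * k y) A A' x
      = h x * F.partialS k A A' x + k x * F.partialS h A A' x := by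
  simp only [partialS, Finset.mul_sum, ← Finset.sum_add_distrib, mvfderiv_mul_complex hh hk]
  exact Finset.sum_congr rfl fun i _ ↦ by ring

lemma partialS_const_mul (c : ℂ) (hh : MDifferentiableAt (𝓡 4) 𝓘(ℝ, ℂ) h x) :
    F.partialS (fun y ↦ c * h y) A A' x = c * F.partialS h A A' x := by
  rw [F.partialS_mul A A' mdifferentiableAt_const hh, partialS_const, mul_zero, add_zero]

lemma partialS_sub (hh : MDifferentiableAt (𝓡 4) 𝓘(ℝ, ℂ) h x)
    (hk : MDifferentiableAt (𝓡 4) 𝓘(ℝ, ℂ) k x) :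
    F.partialS (fun y ↦ h y - k y) A A' x = F.partialS h A A' x - F.partialS k A A' x := by
  have key := mvfderiv_sub hh hk
  simp only [partialS, ← Finset.sum_sub_distrib, ← mul_sub]
  refine Finset.sum_congr rfl fun i _ ↦ congrArg _ ?_
  exact congrArg (fun T ↦ T (F.e i x)) key

lemma partialS_inv (hh : MDifferentiableAt (𝓡 4) 𝓘(ℝ, ℂ) h x) (h0 : ∀ y, h y ≠ 0) :
    F.partialS (fun y ↦ (h y)⁻¹) A A' x = -(h x)⁻¹ * ((h x)⁻¹ * F.partialS h A A' x) := by
  have key := F.partialS_mul A A' hh (hh.inv_complex (h0 x))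
  simp only [fun y ↦ mul_inv_cancel₀ (h0 y), partialS_const] at key
  have := mul_inv_cancel₀ (h0 x)
  linear_combination (-(h x)⁻¹) * key - F.partialS (fun y ↦ (h y)⁻¹) A A' x * this

/-! ### The spin connection is trace-free -/

lemma koszul_self (i j : Fin 4) : koszul g (F.e i) (F.e j) (F.e j) x = 0 := by
  have hc : (fun y ↦ g.inner y (F.e j y) (F.e j y)) = fun _ ↦ minkowski j j :=
    funext fun y ↦ F.orthonormal j j y
  have hs : (fun y ↦ g.inner y (F.e j y) (F.e i y)) = fun y ↦ g.inner y (F.e i y) (F.e j y) :=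
    funext fun y ↦ g.symm y _ _
  simp [koszul, hc, hs, mvfderiv_const,
    VectorField.mlieBracket_swap_apply (V := F.e j) (W := F.e i)]

lemma sum_ivdw_mul_ivdwInv (j k : Fin 4) :
    ∑ B, ∑ B', ivdw k B B' * ivdwInv j B B' = if j = k then 1 else 0 := by
  have h2 : (((√2 : ℝ) : ℂ)⁻¹) ^ 2 = 1 / 2 := by
    rw [inv_pow, ← Complex.ofReal_pow, Real.sq_sqrt zero_le_two]; norm_num
  have hI := Complex.I_sq
  fin_cases j <;> fin_cases k <;>
    simp [ivdw, ivdwInv, eps, minkowski, Fin.sum_univ_two] <;> ring_nf <;> grind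

lemma spinConn_trace (F : SpinFrame g) (A A' : Fin 2) (x : M) :
    ∑ B, F.spinConn A A' B B x = 0 := by
  have swap : ∑ B, F.spinConn A A' B B x = (1 / 2 : ℂ) * ∑ i, ∑ j, ∑ k, ivdwInv i A A' *
      (∑ B, ∑ B', ivdw k B B' * ivdwInv j B B') *
      ((minkowski k k * koszul g (F.e i) (F.e j) (F.e k) x : ℝ) : ℂ) := by
    simp only [spinConn, ← Finset.mul_sum]
    rw [Finset.sum_comm]
    congr 1
    refine Finset.sum_congr rfl fun i _ ↦ ?_
    rw [Finset.sum_comm]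
    refine Finset.sum_congr rfl fun j _ ↦ ?_
    rw [Finset.sum_comm]
    refine Finset.sum_congr rfl fun k _ ↦ ?_
    simp only [Finset.mul_sum, Finset.sum_mul]
    exact Finset.sum_congr rfl fun _ _ ↦ Finset.sum_congr rfl fun _ _ ↦ by ring
  simp only [swap, sum_ivdw_mul_ivdwInv]
  simp [koszul_self]

end SpinFrame

/-! ### Derivatives of the dyad -/

namespace SpinDyad

variable {F : SpinFrame g} (d : SpinDyad F)

lemma mdifferentiableAt_o (A : Fin 2) (x : M) :
    MDifferentiableAt (𝓡 4) 𝓘(ℝ, ℂ) (fun y ↦ d.o y A) x :=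
  (d.contMDiff_o A).mdifferentiableAt (by simp)

lemma mdifferentiableAt_iota (A : Fin 2) (x : M) :
    MDifferentiableAt (𝓡 4) 𝓘(ℝ, ℂ) (fun y ↦ d.iota y A) x :=
  (d.contMDiff_iota A).mdifferentiableAt (by simp)

lemma _root_.SpinGeometry.lower_zero (ψ : Fin 2 → ℂ) : lower ψ 0 = -ψ 1 := by
  simp [lower, eps]

lemma _root_.SpinGeometry.lower_one (ψ : Fin 2 → ℂ) : lower ψ 1 = ψ 0 := by
  simp [lower, eps]

lemma normalized_expanded (x : M) :
    d.o x 0 * d.iota x 1 - d.o x 1 * d.iota x 0 = 1 := by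
  have := d.normalized x
  simp [lower, eps, Fin.sum_univ_two] at this
  linear_combination this

/-- `ι^B ∇_a o_B = o^B ∇_a ι_B`. -/
lemma iota_nabla_o (A A' : Fin 2) (x : M) :
    ∑ B, d.iota x B * F.nabla₁ (fun y ↦ lower (d.o y)) A A' B x
      = ∑ B, d.o x B * F.nabla₁ (fun y ↦ lower (d.iota y)) A A' B x := by
  have ho := fun B ↦ d.mdifferentiableAt_o B x
  have hi := fun B ↦ d.mdifferentiableAt_iota B x
  have key := F.partialS_sub A A' ((ho 0).mul (hi 1)) ((ho 1).mul (hi 0))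
  simp only [Pi.mul_apply, normalized_expanded, F.partialS_const] at key
  have e1 := F.partialS_mul A A' (ho 0) (hi 1)
  have e2 := F.partialS_mul A A' (ho 1) (hi 0)
  have n1 : ∀ h : M → ℂ, MDifferentiableAt (𝓡 4) 𝓘(ℝ, ℂ) h x →
      F.partialS (fun y ↦ -h y) A A' x = -F.partialS h A A' x := fun h hh ↦ by
    simpa using F.partialS_const_mul A A' (-1) hh
  have tr := F.spinConn_trace A A' x
  simp only [Fin.sum_univ_two] at tr
  simp only [SpinFrame.nabla₁, lower, eps, Fin.sum_univ_two, Matrix.of_apply, Matrix.cons_val',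
    Matrix.cons_val_zero, Matrix.cons_val_one, Matrix.cons_val_fin_one, mul_zero, mul_one,
    mul_neg, zero_add, add_zero, n1 _ (ho 1), n1 _ (hi 1)]
  change 0 = F.partialS (fun y ↦ d.o y 0 * d.iota y 1) A A' x
    - F.partialS (fun y ↦ d.o y 1 * d.iota y 0) A A' x at key
  rw [e1, e2] at key
  linear_combination -key + (d.o x 1 * d.iota x 0 - d.o x 0 * d.iota x 1) * tr

/-- The Leibniz rule for `K_{BC} = φ⁻¹ [o_{(B} ι_{C)} - η o_B o_C]`. -/
lemma nabla₂_killing {φ η : M → ℂ} {x : M} (hφ : MDifferentiableAt (𝓡 4) 𝓘(ℝ, ℂ) φ x)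
    (hη : MDifferentiableAt (𝓡 4) 𝓘(ℝ, ℂ) η x) (hφ0 : ∀ y, φ y ≠ 0) (A A' B C : Fin 2) :
    F.nabla₂ (d.killing φ η) A A' B C x
      = (φ x)⁻¹ * (-((φ x)⁻¹ * F.partialS φ A A' x) *
          ((1 / 2 : ℂ) * (lower (d.o x) B * lower (d.iota x) C
            + lower (d.iota x) B * lower (d.o x) C) - η x * lower (d.o x) B * lower (d.o x) C)
        + (1 / 2 : ℂ) * (F.nabla₁ (fun y ↦ lower (d.o y)) A A' B x * lower (d.iota x) C
          + lower (d.o x) B * F.nabla₁ (fun y ↦ lower (d.iota y)) A A' C x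
          + F.nabla₁ (fun y ↦ lower (d.iota y)) A A' B x * lower (d.o x) C
          + lower (d.iota x) B * F.nabla₁ (fun y ↦ lower (d.o y)) A A' C x)
        - F.partialS η A A' x * lower (d.o x) B * lower (d.o x) C
        - η x * (F.nabla₁ (fun y ↦ lower (d.o y)) A A' B x * lower (d.o x) C
          + lower (d.o x) B * F.nabla₁ (fun y ↦ lower (d.o y)) A A' C x)) := by
  have ho := MDifferentiableAt.lower fun B ↦ d.mdifferentiableAt_o B x
  have hi := MDifferentiableAt.lower fun B ↦ d.mdifferentiableAt_iota B x
  have hoi := (ho B).mul (hi C)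
  have hio := (hi B).mul (ho C)
  have hs := hoi.add hio
  have hs' := (mdifferentiableAt_const (c := (1 / 2 : ℂ))).mul hs
  have hηo := hη.mul (ho B)
  have hηoo := hηo.mul (ho C)
  have e : F.partialS (fun y ↦ d.killing φ η y B C) A A' x = _ :=
    F.partialS_mul A A' (hφ.inv_complex (hφ0 x)) (hs'.sub hηoo)
  have e1 := F.partialS_sub A A' hs' hηoo
  have e2 := F.partialS_const_mul A A' (1 / 2 : ℂ) hs
  have e3 := F.partialS_add A A' hoi hio
  have e4 := F.partialS_mul A A' (ho B) (hi C)
  have e5 := F.partialS_mul A A' (hi B) (ho C)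
  have e6 := F.partialS_mul A A' hηo (ho C)
  have e7 := F.partialS_mul A A' hη (ho B)
  have e8 := F.partialS_inv A A' hφ hφ0
  simp only [SpinFrame.nabla₂, SpinFrame.nabla₁, Fin.sum_univ_two]
  rw [e]
  simp only [Pi.mul_def, Pi.add_def] at *
  rw [e1, e2, e3, e4, e5, e6, e7, e8]
  simp only [killing]
  ring

/-! ### The forms `f`, `ω + B` and the operator `C̃` -/

/-- The primed spinor `ψ^B α^A ∇_{AA'} χ_B`. -/
def _root_.SpinGeometry.SpinFrame.coeffS (F : SpinFrame g) (ψ α χ : M → Fin 2 → ℂ) (A' : Fin 2)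
    (x : M) : ℂ :=
  ∑ A, ∑ B, ψ x B * α x A * F.nabla₁ (fun y ↦ lower (χ y)) A A' B x

lemma _root_.SpinGeometry.SpinFrame.coeff_eq (F : SpinFrame g) (ψ α μ χ : M → Fin 2 → ℂ) (x : M) :
    F.coeff ψ α μ χ x = ∑ A', conjS (μ x) A' * F.coeffS ψ α χ A' x := by
  simp only [SpinFrame.coeff, SpinFrame.coeffS, Fin.sum_univ_two]
  ring

/-- `v_{A'} = (v_{B'} ῑ^{B'}) ō_{A'} - (v_{B'} ō^{B'}) ῑ_{A'}`. -/
lemma primed_expansion (v : Fin 2 → ℂ) (A' : Fin 2) (x : M) :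
    (∑ B', conjS (d.iota x) B' * v B') * lower (conjS (d.o x)) A'
      - (∑ B', conjS (d.o x) B' * v B') * lower (conjS (d.iota x)) A' = v A' := by
  have key := congrArg (starRingEnd ℂ) (d.normalized_expanded x)
  simp only [map_sub, map_mul, map_one] at key
  fin_cases A' <;> simp [lower, eps, conjS, Fin.sum_univ_two]
  · linear_combination v 0 * key
  · linear_combination v 1 * key

lemma f_eq (A A' : Fin 2) (x : M) :
    d.f A A' x = -lower (d.iota x) A * F.coeffS d.o d.iota d.o A' x
      - lower (d.o x) A * F.coeffS d.iota d.o d.iota A' x := by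
  have h1 := d.primed_expansion (fun B' ↦ F.coeffS d.o d.iota d.o B' x) A' x
  have h2 := d.primed_expansion (fun B' ↦ F.coeffS d.iota d.o d.iota B' x) A' x
  simp only [f, rho, tau, rho', tau', l, n, m, mbar, SpinFrame.coeff_eq]
  linear_combination -lower (d.iota x) A * h1 - lower (d.o x) A * h2

lemma omega_add_formB_eq (A A' : Fin 2) (x : M) :
    d.omega A A' x + d.formB A A' x
      = lower (d.iota x) A * (F.coeffS d.iota d.o d.o A' x + F.coeffS d.o d.iota d.o A' x)
        - lower (d.o x) A * F.coeffS d.o d.iota d.iota A' x := by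
  have h1 := d.primed_expansion (fun B' ↦ F.coeffS d.iota d.o d.o B' x) A' x
  have h2 := d.primed_expansion (fun B' ↦ F.coeffS d.o d.iota d.o B' x) A' x
  have h3 := d.primed_expansion (fun B' ↦ F.coeffS d.o d.iota d.iota B' x) A' x
  simp only [omega, formB, epsilon, epsilon', beta, beta', rho, tau, l, n, m, mbar,
    SpinFrame.coeff_eq]
  linear_combination lower (d.iota x) A * (h1 + h2) - lower (d.o x) A * h3

lemma sum_o_lower_o (x : M) : ∑ A, d.o x A * lower (d.o x) A = 0 := by
  simp [lower, eps, Fin.sum_univ_two]; ring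

lemma sum_o_lower_iota (x : M) : ∑ A, d.o x A * lower (d.iota x) A = -1 := by
  simp [lower, eps, Fin.sum_univ_two]
  linear_combination -d.normalized_expanded x

lemma sum_iota_lower_o (x : M) : ∑ A, d.iota x A * lower (d.o x) A = 1 := by
  simp [lower, eps, Fin.sum_univ_two]
  linear_combination d.normalized_expanded x

lemma sum_iota_lower_iota (x : M) : ∑ A, d.iota x A * lower (d.iota x) A = 0 := by
  simp [lower, eps, Fin.sum_univ_two]; ring

lemma projC_eq (p w : ℤ) (h : M → ℂ) (A' : Fin 2) (x : M) :
    d.projC p w h A' x = ∑ A, d.o x A * F.partialS h A A' x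
      + (w * F.coeffS d.o d.iota d.o A' x
        - p * (F.coeffS d.iota d.o d.o A' x + F.coeffS d.o d.iota d.o A' x)) * h x := by
  have h1 := d.sum_o_lower_o x
  have h2 := d.sum_o_lower_iota x
  simp only [projC, confGHP, f_eq, omega_add_formB_eq, Fin.sum_univ_two] at *
  linear_combination
    (-w * F.coeffS d.iota d.o d.iota A' x - p * F.coeffS d.o d.iota d.iota A' x) * h x * h1
    + (-w * F.coeffS d.o d.iota d.o A' x
      + p * (F.coeffS d.iota d.o d.o A' x + F.coeffS d.o d.iota d.o A' x)) * h x * h2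

/-- A symmetric spinor vanishes if its three dyad components do. -/
lemma eq_zero_of_components {S : Fin 2 → Fin 2 → ℂ} (hS : ∀ B C, S B C = S C B) (x : M)
    (h0 : ∑ B, ∑ C, d.o x B * d.o x C * S B C = 0)
    (h1 : ∑ B, ∑ C, d.o x B * d.iota x C * S B C = 0)
    (h2 : ∑ B, ∑ C, d.iota x B * d.iota x C * S B C = 0) (B C : Fin 2) : S B C = 0 := by
  have key := d.normalized_expanded x
  have h01 := hS 1 0
  simp only [Fin.sum_univ_two, h01] at h0 h1 h2
  have e : ∀ s : ℂ, s = s * (d.o x 0 * d.iota x 1 - d.o x 1 * d.iota x 0) ^ 2 := fun s ↦ by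
    rw [key]; ring
  fin_cases B <;> fin_cases C <;> simp only [Fin.zero_eta, Fin.mk_one, h01]
  · rw [e (S 0 0)]
    linear_combination d.iota x 1 ^ 2 * h0 - 2 * d.o x 1 * d.iota x 1 * h1 + d.o x 1 ^ 2 * h2
  all_goals try rw [e (S 0 1)]
  · linear_combination -d.iota x 0 * d.iota x 1 * h0
      + (d.o x 0 * d.iota x 1 + d.o x 1 * d.iota x 0) * h1 - d.o x 0 * d.o x 1 * h2
  · linear_combination -d.iota x 0 * d.iota x 1 * h0
      + (d.o x 0 * d.iota x 1 + d.o x 1 * d.iota x 0) * h1 - d.o x 0 * d.o x 1 * h2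
  · rw [e (S 1 1)]
    linear_combination d.iota x 0 ^ 2 * h0 - 2 * d.o x 0 * d.iota x 0 * h1 + d.o x 0 ^ 2 * h2

section

variable {φ η : M → ℂ} {x : M} {A' : Fin 2}

/-- The contraction of the decomposition of `f` with `o^A`:
`φ⁻¹ o^A ∇_{AA'} φ = o^B ι^A ∇_{AA'} o_B`. -/
lemma o_partialS_phi (hf : ∀ A, d.f A A' x =
      (φ x)⁻¹ * F.partialS φ A A' x - lower (d.o x) A * d.projC (-2) (-1) η A' x) :
    ∑ A, d.o x A * ((φ x)⁻¹ * F.partialS φ A A' x) = F.coeffS d.o d.iota d.o A' x := by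
  have h1 := d.sum_o_lower_o x
  have h2 := d.sum_o_lower_iota x
  have f0 := hf 0
  have f1 := hf 1
  simp only [f_eq, Fin.sum_univ_two] at *
  linear_combination -d.o x 0 * f0 - d.o x 1 * f1 - F.coeffS d.o d.iota d.o A' x * h2
    + (d.projC (-2) (-1) η A' x - F.coeffS d.iota d.o d.iota A' x) * h1

/-- The contraction of the decomposition of `f` with `ι^A`. -/
lemma iota_partialS_phi (hf : ∀ A, d.f A A' x =
      (φ x)⁻¹ * F.partialS φ A A' x - lower (d.o x) A * d.projC (-2) (-1) η A' x) :
    ∑ A, d.iota x A * ((φ x)⁻¹ * F.partialS φ A A' x)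
      = -F.coeffS d.iota d.o d.iota A' x + ∑ A, d.o x A * F.partialS η A A' x
        + (F.coeffS d.o d.iota d.o A' x + 2 * F.coeffS d.iota d.o d.o A' x) * η x := by
  have h1 := d.sum_iota_lower_o x
  have h2 := d.sum_iota_lower_iota x
  have hp := d.projC_eq (-2) (-1) η A' x
  have f0 := hf 0
  have f1 := hf 1
  push_cast at hp
  simp only [f_eq, Fin.sum_univ_two] at *
  linear_combination -d.iota x 0 * f0 - d.iota x 1 * f1 - F.coeffS d.o d.iota d.o A' x * h2
    + (d.projC (-2) (-1) η A' x - F.coeffS d.iota d.o d.iota A' x) * h1 + hp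

end

end SpinDyad

end SpinGeometry

end

theorem f_decomposition_gives_projKS
    {M : Type*} [TopologicalSpace M] [ChartedSpace (EuclideanSpace ℝ (Fin 4)) M]
    [IsManifold (𝓡 4) ∞ M] (g : LorentzianMetric M) (F : SpinFrame g) (d : SpinDyad F)
    (hSFR : IsShearFreeRay F d.o) (hPND : IsRepeatedPrincipalSpinor F d.o)
    (φ η : M → ℂ) (hφ : ContMDiff (𝓡 4) 𝓘(ℝ, ℂ) ∞ φ) (hη : ContMDiff (𝓡 4) 𝓘(ℝ, ℂ) ∞ η)
    (hφ0 : ∀ x, φ x ≠ 0)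
    -- `f_{AA'} = ∇_{AA'} log φ - o_A C̃_{A'} η`, where `∇ log φ` is `φ⁻¹ ∇φ`
    (hf : ∀ (A A' : Fin 2) (x : M), d.f A A' x =
      (φ x)⁻¹ * F.partialS φ A A' x - lower (d.o x) A * d.projC (-2) (-1) η A' x) :
    ProjectedKillingSpinorEq F d.o (d.killing φ η) := by
  intro A' B C x
  have hD := d.o_partialS_phi (fun A ↦ hf A A' x)
  have hΔ := d.iota_partialS_phi (fun A ↦ hf A A' x)
  have hsf := hSFR A' x
  have htr := fun A ↦ d.iota_nabla_o A A' x
  have tr0 := htr 0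
  have tr1 := htr 1
  have hN := d.normalized_expanded x
  have hK := fun A B C ↦ d.nabla₂_killing (hφ.mdifferentiableAt (by simp))
    (hη.mdifferentiableAt (by simp)) hφ0 A A' B C (x := x)
  refine d.eq_zero_of_components
    (S := fun B C ↦ ∑ A, d.o x A * sym₃ (fun A B C ↦ F.nabla₂ (d.killing φ η) A A' B C x) A B C)
    (fun B C ↦ Finset.sum_congr rfl fun A _ ↦ by simp only [sym₃]; ring) x ?_ ?_ ?_ B C
  all_goals
    simp only [sym₃, hK, SpinFrame.coeffS, Fin.sum_univ_two] at *
    simp only [lower_zero, lower_one] at *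
    generalize F.nabla₁ (fun y ↦ lower (d.o y)) = P at *
    generalize F.nabla₁ (fun y ↦ lower (d.iota y)) = Q at *
    let N := d.o x 0 * d.iota x 1 - d.o x 1 * d.iota x 0
    let r := d.o x 0 * d.iota x 0 * P 0 A' 0 x + d.o x 1 * d.iota x 0 * P 0 A' 1 x
      + (d.o x 0 * d.iota x 1 * P 1 A' 0 x + d.o x 1 * d.iota x 1 * P 1 A' 1 x)
    let a := d.iota x 0 * d.o x 0 * P 0 A' 0 x + d.iota x 1 * d.o x 0 * P 0 A' 1 x
      + (d.iota x 0 * d.o x 1 * P 1 A' 0 x + d.iota x 1 * d.o x 1 * P 1 A' 1 x)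
    let c := d.iota x 0 * d.o x 0 * Q 0 A' 0 x + d.iota x 1 * d.o x 0 * Q 0 A' 1 x
      + (d.iota x 0 * d.o x 1 * Q 1 A' 0 x + d.iota x 1 * d.o x 1 * Q 1 A' 1 x)
  · linear_combination -N * (φ x)⁻¹ * hsf
  · linear_combination (φ x)⁻¹ / 3 * (N ^ 2 * hD
      - N * (d.o x 0 * tr0 + d.o x 1 * tr1) - 2 * η x * N * hsf
      + N * r * hN)
  · linear_combination (φ x)⁻¹ / 3 * (η x * N ^ 2 * hD + N ^ 2 * hΔ
      - N * (d.iota x 0 * tr0 + d.iota x 1 * tr1) + N * (-c + 2 * η x * a + 2 * η x * r) * hN)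
end

section
/- Let $(M,g)$ be a smooth four-dimensional Lorentzian spacetime of signature $(+,-,-,-)$ with spinor bundles $\mathbb S,\mathbb S'$, $TM\otimes\mathbb C\cong\mathbb S\otimes\mathbb S'$, $g_{ab}=\epsilon_{AB}\bar\epsilon_{A'B'}$, and let $\nabla_{AA'}$ be the Levi-Civita (spinor) connection. Let $(o^A,\iota^A)$ be a smooth spin dyad on $M$, $o_A\iota^A=1$, such that $o^A$ is a shear-free ray, i.e. $o^Ao^B\nabla_{AA'}o_B=0$. Suppose that the Weyl scalar $\Psi_1=\Psi_{ABCD}\,o^Ao^Bo^C\iota^D$ is nowhere vanishing, where $\Psi_{ABCD}$ is the (anti-self-dual) Weyl spinor of $g$. Then the only smooth symmetric spinor field $K_{AB}=K_{(AB)}$ on $M$ solving the projected Killing spinor equation $$o^A\nabla_{A'(A}K_{BC)}=0$$ is $K_{AB}=0$. -/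
open scoped Manifold ContDiff

noncomputable section

namespace TwoSpinor

/-! ## Lorentzian metrics -/

/-- A smooth Lorentzian metric of signature `(+,-,-,-)` on a smooth 4-manifold. -/
structure LorentzMetric (M : Type*) [TopologicalSpace M]
    [ChartedSpace (EuclideanSpace ℝ (Fin 4)) M] [IsManifold (𝓡 4) ∞ M] where
  /-- the bilinear form `g_x` on the tangent space `T_x M` -/
  val (x : M) : TangentSpace (𝓡 4) x →L[ℝ] TangentSpace (𝓡 4) x →L[ℝ] ℝ
  symm (x : M) (v w : TangentSpace (𝓡 4) x) : val x v w = val x w v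
  signature (x : M) : ∃ b : Module.Basis (Fin 4) ℝ (TangentSpace (𝓡 4) x),
    ∀ i j, val x (b i) (b j) = if i = j then (if i = 0 then 1 else -1) else 0
  contMDiff : ContMDiff (𝓡 4)
    ((𝓡 4).prod 𝓘(ℝ, EuclideanSpace ℝ (Fin 4) →L[ℝ] EuclideanSpace ℝ (Fin 4) →L[ℝ] ℝ)) ∞
    (fun x ↦ Bundle.TotalSpace.mk'
      (EuclideanSpace ℝ (Fin 4) →L[ℝ] EuclideanSpace ℝ (Fin 4) →L[ℝ] ℝ) x (val x))

/-! ## Two-component spinor algebra -/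

/-- Components of `ε_{AB}`, of `ε^{AB}`, and of their complex conjugates
(`ε_{01} = ε^{01} = 1`; all four arrays coincide). -/
def eps (A B : Fin 2) : ℂ := !![0, 1; -1, 0] A B

/-- Hermitian `2 × 2` matrices `V^{AA'}`: the real elements of `𝕊 ⊗ 𝕊'`. -/
abbrev HermBispinor := selfAdjoint (Matrix (Fin 2) (Fin 2) ℂ)

/-- A spacetime index `a` written as a pair of spinor indices `AA'`. -/
abbrev Idx := Fin 2 × Fin 2

/-- The components `g_{ab} = ε_{AB} ε̄_{A'B'}`; the inverse metric `g^{ab} = ε^{AB} ε̄^{A'B'}` has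
the same components. -/
def gEps (a b : Idx) : ℂ := eps a.1 b.1 * eps a.2 b.2

/-- The lowered components `κ_B = κ^A ε_{AB}` of a spinor `κ^A`. -/
def lower (κ : Fin 2 → ℂ) (B : Fin 2) : ℂ := ∑ A, κ A * eps A B

/-- Total symmetrization `T_{(ABC)}`. -/
def sym3 (T : Fin 2 → Fin 2 → Fin 2 → ℂ) (A B C : Fin 2) : ℂ :=
  (1 / 6) * (T A B C + T A C B + T B A C + T B C A + T C A B + T C B A)

variable {M : Type*} [TopologicalSpace M] [ChartedSpace (EuclideanSpace ℝ (Fin 4)) M]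

/-- A smooth spin dyad `(o^A, ι^A)`, normalized by `o_A ι^A = 1`. Spinor fields are given by their
components `M → ℂ²` in a reference spin frame, see `SpinStructure`. -/
structure SpinDyad (M : Type*) [TopologicalSpace M]
    [ChartedSpace (EuclideanSpace ℝ (Fin 4)) M] where
  o : M → Fin 2 → ℂ
  ι : M → Fin 2 → ℂ
  contMDiff_o : ContMDiff (𝓡 4) 𝓘(ℝ, Fin 2 → ℂ) ∞ o
  contMDiff_ι : ContMDiff (𝓡 4) 𝓘(ℝ, Fin 2 → ℂ) ∞ ι
  normalized (x : M) : ∑ A, lower (o x) A * ι x A = 1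

variable [IsManifold (𝓡 4) ∞ M]

/-- The spinor bundle of a spacetime `(M, g)` and its soldering to the tangent bundle.

A spin dyad on `M` trivializes the spinor bundle `𝕊`, so `𝕊` is taken to be `M × ℂ²` with the
standard symplectic form `ε_{AB}` and `𝕊'` its complex conjugate. The bundle isomorphism
`𝕊 ⊗ 𝕊' ≅ TM ⊗ ℂ` with `g_{ab} = ε_{AB} ε̄_{A'B'}` is given by its restriction to the real
elements, the Hermitian matrices `V^{AA'}`. The reference frame is arbitrary: it need not be the
dyad that appears in a result. -/
structure SpinStructure (g : LorentzMetric M) where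
  solder (x : M) : HermBispinor ≃ₗ[ℝ] TangentSpace (𝓡 4) x
  contMDiff_solder (V : HermBispinor) : ContMDiff (𝓡 4) ((𝓡 4).prod 𝓘(ℝ, EuclideanSpace ℝ (Fin 4)))
    ∞ (fun x ↦ (⟨x, solder x V⟩ : TangentBundle (𝓡 4) M))
  metric_solder (x : M) (V W : HermBispinor) :
    (g.val x (solder x V) (solder x W) : ℂ) =
      ∑ a : Idx, ∑ b : Idx, gEps a b * V.1 a.1 a.2 * W.1 b.1 b.2

namespace SpinStructure

variable {g : LorentzMetric M} (S : SpinStructure g)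

/-! ## The complex null frame `∂_a = ∂_{AA'}` of `TM ⊗ ℂ`

`∂_{AA'}` corresponds to the matrix unit `E_{AA'}`, so that `V^a ∂_a` is the complex vector with
spinor components `V^{AA'}`. It is written as `∂_a = frameRe a + i frameIm a`. -/

/-- The real part of the frame field `∂_a`. -/
def frameRe (a : Idx) (x : M) : TangentSpace (𝓡 4) x :=
  S.solder x (realPart (Matrix.single a.1 a.2 (1 : ℂ)))

/-- The imaginary part of the frame field `∂_a`. -/
def frameIm (a : Idx) (x : M) : TangentSpace (𝓡 4) x :=
  S.solder x (imaginaryPart (Matrix.single a.1 a.2 (1 : ℂ)))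

/-- The derivative `∂_a f` of a complex function `f`. -/
def pd (a : Idx) (f : M → ℂ) (x : M) : ℂ :=
  mvfderiv (𝓡 4) f x (S.frameRe a x) + Complex.I * mvfderiv (𝓡 4) f x (S.frameIm a x)

/-- The spinor components `v^c = v^{CC'}` of a real tangent vector `v`. -/
def comp (x : M) (v : TangentSpace (𝓡 4) x) (c : Idx) : ℂ :=
  ((S.solder x).symm v).1 c.1 c.2

/-- The structure functions `c_{ab}{}^c` of the frame: `[∂_a, ∂_b] = c_{ab}{}^c ∂_c`, the Lie bracket
of real vector fields being extended complex bilinearly. -/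
def bracket (a b c : Idx) (x : M) : ℂ :=
  S.comp x (VectorField.mlieBracket (𝓡 4) (S.frameRe a) (S.frameRe b) x) c
    - S.comp x (VectorField.mlieBracket (𝓡 4) (S.frameIm a) (S.frameIm b) x) c
    + Complex.I * (S.comp x (VectorField.mlieBracket (𝓡 4) (S.frameRe a) (S.frameIm b) x) c
      + S.comp x (VectorField.mlieBracket (𝓡 4) (S.frameIm a) (S.frameRe b) x) c)

/-- `g([∂_a, ∂_b], ∂_c)`. -/
def bracketLow (a b c : Idx) (x : M) : ℂ := ∑ d, S.bracket a b d x * gEps d c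

/-! ## The Levi-Civita connection and its curvature -/

/-- `g(∇_a ∂_b, ∂_c)` for the Levi-Civita connection `∇`, by the Koszul formula
`2 g(∇_X Y, Z) = g([X,Y],Z) - g([X,Z],Y) - g([Y,Z],X)`, valid for frame fields because their
inner products `g(∂_a, ∂_b) = ε_{AB} ε̄_{A'B'}` are constant. -/
def connLow (a b c : Idx) (x : M) : ℂ :=
  (1 / 2) * (S.bracketLow a b c x - S.bracketLow a c b x - S.bracketLow b c a x)

/-- The connection coefficients `γ_{ab}{}^c`: `∇_a ∂_b = γ_{ab}{}^c ∂_c`. -/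
def conn (a b c : Idx) (x : M) : ℂ := ∑ d, gEps c d * S.connLow a b d x

/-- The Riemann tensor `R_{abc}{}^d`, with
`(∇_X ∇_Y - ∇_Y ∇_X - ∇_{[X,Y]}) Z = R_{abc}{}^d X^a Y^b Z^c`. -/
def riemann (a b c d : Idx) (x : M) : ℂ :=
  S.pd a (S.conn b c d) x - S.pd b (S.conn a c d) x
    + ∑ e, (S.conn b c e x * S.conn a e d x - S.conn a c e x * S.conn b e d x)
    - ∑ e, S.bracket a b e x * S.conn e c d x

/-- The Riemann tensor `R_{abcd}`. -/
def riemannLow (a b c d : Idx) (x : M) : ℂ := ∑ e, S.riemann a b c e x * gEps e d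

/-- The curvature spinor `X_{ABCD} = ¼ ε̄^{A'B'} ε̄^{C'D'} R_{AA'BB'CC'DD'}`. -/
def curvSpinor (A B C D : Fin 2) (x : M) : ℂ :=
  (1 / 4) * ∑ A', ∑ B', ∑ C', ∑ D',
    eps A' B' * eps C' D' * S.riemannLow (A, A') (B, B') (C, C') (D, D') x

/-- The (anti-self-dual) Weyl spinor `Ψ_{ABCD} = X_{(ABCD)}`; the components `A, B, C, D` are the
values `i 0, i 1, i 2, i 3`. -/
def weylSpinor (i : Fin 4 → Fin 2) (x : M) : ℂ :=
  (1 / 24) * ∑ π : Equiv.Perm (Fin 4), S.curvSpinor (i (π 0)) (i (π 1)) (i (π 2)) (i (π 3)) x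

/-- The Weyl scalar `Ψ₁ = Ψ_{ABCD} o^A o^B o^C ι^D`. -/
def Psi1 (D : SpinDyad M) (x : M) : ℂ :=
  ∑ i : Fin 4 → Fin 2, S.weylSpinor i x * D.o x (i 0) * D.o x (i 1) * D.o x (i 2) * D.ι x (i 3)

/-! ## The spinor connection -/

/-- The coefficients `Γ_a{}^B{}_C` of the spinor connection in the reference spin frame `(δ_0, δ_1)`:
`∇_a δ_C = Γ_a{}^B{}_C δ_B`. They are determined by `∇ ε = 0` (that is, `Γ_a{}^B{}_B = 0`) and by
the requirement that `∇` induces the Levi-Civita connection on `𝕊 ⊗ 𝕊' ≅ TM ⊗ ℂ`, i.e. that for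
real directions `γ_{a,CC'}{}^{BB'} = Γ_a{}^B{}_C δ_{C'}{}^{B'} + δ_C{}^B conj(Γ_a)^{B'}{}_{C'}`
(extended complex linearly in `a`); contracting `B'` with `C'` gives the formula below. -/
def spinConn (a : Idx) (B C : Fin 2) (x : M) : ℂ :=
  (1 / 2) * ∑ C', S.conn a (C, C') (B, C') x

/-- `∇_a κ_B` for a spinor field `κ_B`. -/
def nabla1 (a : Idx) (κ : M → Fin 2 → ℂ) (B : Fin 2) (x : M) : ℂ :=
  S.pd a (fun y ↦ κ y B) x - ∑ C, S.spinConn a C B x * κ x C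

/-- `∇_a K_{BC}` for a spinor field `K_{BC}`. -/
def nabla2 (a : Idx) (K : M → Fin 2 → Fin 2 → ℂ) (B C : Fin 2) (x : M) : ℂ :=
  S.pd a (fun y ↦ K y B C) x
    - ∑ D, S.spinConn a D B x * K x D C - ∑ D, S.spinConn a D C x * K x B D

/-- `o^A` is a shear-free ray: `o^A o^B ∇_{AA'} o_B = 0`. -/
def IsShearFreeRay (o : M → Fin 2 → ℂ) : Prop :=
  ∀ (x : M) (A' : Fin 2),
    ∑ A, ∑ B, o x A * o x B * S.nabla1 (A, A') (fun y ↦ lower (o y)) B x = 0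

/-- The projected Killing spinor equation `o^A ∇_{A'(A} K_{BC)} = 0`. -/
def ProjKillingSpinorEq (o : M → Fin 2 → ℂ) (K : M → Fin 2 → Fin 2 → ℂ) : Prop :=
  ∀ (x : M) (A' B C : Fin 2),
    ∑ A, o x A * sym3 (fun P Q R ↦ S.nabla2 (P, A') K Q R x) A B C = 0

end SpinStructure

end TwoSpinor

end

open TwoSpinor

noncomputable section

section Manifold

open VectorField Set Filter Topology

variable {E H F M : Type*} [NormedAddCommGroup E] [NormedSpace ℝ E] [TopologicalSpace H]
  [NormedAddCommGroup F] [NormedSpace ℝ F]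
  {I : ModelWithCorners ℝ E H} [TopologicalSpace M] [ChartedSpace H M] [IsManifold I ∞ M]

/-- The derivative of a function along a smooth vector field is smooth. -/
lemma ContMDiffOn.mvfderiv_apply {f : M → F} {U : Set M} (hU : IsOpen U)
    (hf : ContMDiffOn I 𝓘(ℝ, F) ∞ f U) {V : Π x : M, TangentSpace I x}
    (hV : ContMDiff I I.tangent ∞ (fun x ↦ (⟨x, V x⟩ : TangentBundle I M))) :
    ContMDiffOn I 𝓘(ℝ, F) ∞ (fun x ↦ mvfderiv I f x (V x)) U := by
  have : IsManifold I 1 M := IsManifold.of_le (n := ∞) (by simp)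
  have h1 : ContMDiffOn I.tangent 𝓘(ℝ, F).tangent ∞ (tangentMapWithin I 𝓘(ℝ, F) f U)
      (Bundle.TotalSpace.proj ⁻¹' U) :=
    hf.contMDiffOn_tangentMapWithin (by simp) hU.uniqueMDiffOn
  have h2 := h1.comp (t := Bundle.TotalSpace.proj ⁻¹' U) (hV.contMDiffOn (s := U))
    (fun x hx ↦ hx)
  have h3 := (contMDiff_snd_tangentBundle_modelSpace (n := ∞) F 𝓘(ℝ, F)).comp_contMDiffOn h2
  refine h3.congr fun x hx ↦ ?_
  change _ = mfderivWithin I 𝓘(ℝ, F) f U x (V x)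
  rw [mfderivWithin_of_isOpen hU hx]
  rfl

variable [I.Boundaryless]

lemma mvfderiv_eq_fderiv_mpullback {f : M → F} {x : M} {y : E}
    (hy : y ∈ (extChartAt I x).target)
    (hf : MDifferentiableAt I 𝓘(ℝ, F) f ((extChartAt I x).symm y))
    (V : Π x : M, TangentSpace I x) :
    mvfderiv I f ((extChartAt I x).symm y) (V ((extChartAt I x).symm y)) =
      fderiv ℝ (f ∘ (extChartAt I x).symm) y
        (mpullbackWithin 𝓘(ℝ, E) I (extChartAt I x).symm V (range I) y) := by
  have : IsManifold I 1 M := IsManifold.of_le (n := ∞) (by simp)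
  have hinv := isInvertible_mfderivWithin_extChartAt_symm (I := I) hy
  have hs : MDifferentiableWithinAt 𝓘(ℝ, E) I (extChartAt I x).symm (range I) y :=
    mdifferentiableWithinAt_extChartAt_symm hy
  have hc := mfderiv_comp_mfderivWithin (I'' := 𝓘(ℝ, F)) y hf hs
    (uniqueMDiffWithinAt_iff_uniqueDiffWithinAt.2
      (by rw [I.range_eq_univ]; exact uniqueDiffWithinAt_univ))
  rw [← mfderiv_eq_fderiv, ← mfderivWithin_univ, ← I.range_eq_univ, hc]
  simp only [mpullbackWithin_apply]
  have h := hinv.self_apply_inverse (V ((extChartAt I x).symm y))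
  exact (congrArg (mfderiv I 𝓘(ℝ, F) f ((extChartAt I x).symm y)) h).symm

/-- The Lie bracket of vector fields acts on functions as the commutator of derivatives. -/
lemma mvfderiv_mlieBracket [CompleteSpace E] {f : M → F} {U : Set M} (hU : IsOpen U)
    (hf : ContMDiffOn I 𝓘(ℝ, F) ∞ f U) {V W : Π x : M, TangentSpace I x}
    (hV : ContMDiff I I.tangent ∞ (fun x ↦ (⟨x, V x⟩ : TangentBundle I M)))
    (hW : ContMDiff I I.tangent ∞ (fun x ↦ (⟨x, W x⟩ : TangentBundle I M)))
    {x : M} (hx : x ∈ U) :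
    mvfderiv I f x (mlieBracket I V W x) =
      mvfderiv I (fun y ↦ mvfderiv I f y (W y)) x (V x) -
        mvfderiv I (fun y ↦ mvfderiv I f y (V y)) x (W x) := by
  have : IsManifold I 1 M := IsManifold.of_le (n := ∞) (by simp)
  set φ := extChartAt I x with hφ
  have hxt : φ x ∈ φ.target := mem_extChartAt_target x
  have hxx : φ.symm (φ x) = x := extChartAt_to_inv x
  have htgt : φ.target ∈ 𝓝 (φ x) := extChartAt_target_mem_nhds x
  have hnear : ∀ᶠ y in 𝓝 (φ x), y ∈ φ.target ∧ φ.symm y ∈ U := by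
    refine Filter.Eventually.and htgt ?_
    have hc : ContinuousAt φ.symm (φ x) := continuousAt_extChartAt_symm x
    exact hc.eventually_mem (by rw [hxx]; exact hU.mem_nhds hx)
  have hdiff : ∀ {g : M → F}, ContMDiffOn I 𝓘(ℝ, F) ∞ g U → ∀ {y}, y ∈ U →
      MDifferentiableAt I 𝓘(ℝ, F) g y := fun hg y hy ↦
    (hg.contMDiffAt (hU.mem_nhds hy)).mdifferentiableAt (by simp)
  have key : ∀ Z : Π x : M, TangentSpace I x,
      (fun y ↦ mvfderiv I f y (Z y)) ∘ φ.symm =ᶠ[𝓝 (φ x)]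
        fun y ↦ fderiv ℝ (f ∘ φ.symm) y (mpullbackWithin 𝓘(ℝ, E) I φ.symm Z (range I) y) := by
    intro Z
    filter_upwards [hnear] with y hy
    exact mvfderiv_eq_fderiv_mpullback hy.1 (hdiff hf hy.2) Z
  have key2 : ∀ {Z Y : Π x : M, TangentSpace I x},
      ContMDiff I I.tangent ∞ (fun x ↦ (⟨x, Z x⟩ : TangentBundle I M)) →
      mvfderiv I (fun y ↦ mvfderiv I f y (Z y)) x (Y x) =
        fderiv ℝ (fun y ↦ fderiv ℝ (f ∘ φ.symm) y
          (mpullbackWithin 𝓘(ℝ, E) I φ.symm Z (range I) y)) (φ x)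
          (mpullbackWithin 𝓘(ℝ, E) I φ.symm Y (range I) (φ x)) := by
    intro Z Y hZ
    have h := mvfderiv_eq_fderiv_mpullback (I := I) (x := x) hxt
      (f := fun y ↦ mvfderiv I f y (Z y))
      (hdiff (hf.mvfderiv_apply hU hZ) (by rw [← hφ, hxx]; exact hx)) Y
    rw [← hφ] at h
    rw [(key Z).fderiv_eq] at h
    rw [hxx] at h
    exact h
  rw [key2 hW, key2 hV]
  have hpd : ∀ {Z : Π x : M, TangentSpace I x},
      ContMDiff I I.tangent ∞ (fun x ↦ (⟨x, Z x⟩ : TangentBundle I M)) →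
      DifferentiableAt ℝ (mpullbackWithin 𝓘(ℝ, E) I φ.symm Z (range I)) (φ x) := by
    intro Z hZ
    have h := ((hZ x).mdifferentiableAt (by simp)).mdifferentiableWithinAt
      (s := univ) |>.differentiableWithinAt_mpullbackWithin_vectorField
    rw [preimage_univ, univ_inter, I.range_eq_univ] at h
    rw [I.range_eq_univ]
    exact differentiableWithinAt_univ.1 h
  have hfc : ContDiffAt ℝ ∞ (f ∘ φ.symm) (φ x) := by
    have h1 : ContMDiffAt 𝓘(ℝ, E) I ∞ φ.symm (φ x) :=
      (contMDiffOn_extChartAt_symm x).contMDiffAt htgt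
    have h2 : ContMDiffAt I 𝓘(ℝ, F) ∞ f (φ.symm (φ x)) := by
      rw [hxx]; exact hf.contMDiffAt (hU.mem_nhds hx)
    exact contMDiffAt_iff_contDiffAt.1 (h2.comp _ h1)
  have h2 : minSmoothness ℝ 2 ≤ (∞ : WithTop ℕ∞) := by
    simpa using! WithTop.coe_le_coe.2 (le_top : (2 : ℕ∞) ≤ ⊤)
  rw [← fderiv_apply_lieBracket hfc h2 (hpd hW) (hpd hV)]
  have hB : mlieBracket I V W x = lieBracket ℝ (mpullbackWithin 𝓘(ℝ, E) I φ.symm V (range I) : E → E)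
        (mpullbackWithin 𝓘(ℝ, E) I φ.symm W (range I) : E → E) (φ x) := by
    have hinv : ∀ v : TangentSpace 𝓘(ℝ, E) (φ x),
        (mfderiv I 𝓘(ℝ, E) φ x).inverse v = (v : E) := fun v ↦
      ((isInvertible_mfderiv_extChartAt (mem_extChartAt_source x)).inverse_apply_eq).2
        (congrArg (fun L : E →L[ℝ] E ↦ L v) (mfderiv_extChartAt_self (I := I) (x := x))).symm
    refine (hinv _).trans ?_
    rw [preimage_univ, univ_inter, I.range_eq_univ]
    exact congrFun lieBracketWithin_univ (φ x)
  rw [hB]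
  have hfx : mfderiv I 𝓘(ℝ, F) f x = fderiv ℝ (f ∘ φ.symm) (φ x) := by
    refine (hdiff hf hx).mfderiv.trans ?_
    rw [I.range_eq_univ]
    exact congrFun (fderivWithin_univ (𝕜 := ℝ) (f := f ∘ φ.symm)) (φ x)
  exact congrArg (fun L : E →L[ℝ] F ↦ L _) hfx

end Manifold
end

noncomputable section

namespace TwoSpinor

/-! ## Algebraic spinor connections

The connection and curvature of a spinor frame over a commutative ring of functions, the frame
fields acting as derivations. The unprimed and primed connections are independent. -/

section Algebra

variable {R : Type*} [CommRing R]

/-- The coefficients of the connection on `𝕊 ⊗ 𝕊'` induced by connections on `𝕊` and `𝕊'`. -/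
def tensorConn (Γ Γ' : Idx → Fin 2 → Fin 2 → R) (a b c : Idx) : R :=
  (if b.2 = c.2 then Γ a c.1 b.1 else 0) + (if b.1 = c.1 then Γ' a c.2 b.2 else 0)

lemma sum_tensorConn_mul (Γ Γ' : Idx → Fin 2 → Fin 2 → R) (a b : Idx) (F : Idx → R) :
    ∑ e, tensorConn Γ Γ' a b e * F e =
      ∑ E, Γ a E b.1 * F (E, b.2) + ∑ E', Γ' a E' b.2 * F (b.1, E') := by
  obtain ⟨B, B'⟩ := b
  simp only [tensorConn, Fintype.sum_prod_type, add_mul, Finset.sum_add_distrib, ite_mul, zero_mul]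
  simp

lemma map_tensorConn {R' : Type*} [CommRing R'] (φ : R →+* R') (Γ Γ' : Idx → Fin 2 → Fin 2 → R)
    (a b c : Idx) : φ (tensorConn Γ Γ' a b c) =
      tensorConn (fun a B C ↦ φ (Γ a B C)) (fun a B C ↦ φ (Γ' a B C)) a b c := by
  simp [tensorConn, apply_ite φ]

/-- A torsion-free spinor connection with respect to frame derivations `d a`: `Γ a B C` is
`Γ_a{}^B{}_C` and `Γ' a B' C'` is the connection of the primed spinors. -/
structure SpinFrame (R : Type*) [CommRing R] where
  d : Idx → Derivation ℤ R R
  Γ : Idx → Fin 2 → Fin 2 → R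
  Γ' : Idx → Fin 2 → Fin 2 → R
  trace_eq (a : Idx) : Γ a 1 1 = -Γ a 0 0
  trace_eq' (a : Idx) : Γ' a 1 1 = -Γ' a 0 0
  torsion_eq (a b : Idx) (f : R) : d a (d b f) - d b (d a f) =
    ∑ e, (tensorConn Γ Γ' a b e - tensorConn Γ Γ' b a e) * d e f

namespace SpinFrame

variable (s : SpinFrame R)

/-- The coefficients of the connection on vectors. -/
def γ (a b c : Idx) : R := tensorConn s.Γ s.Γ' a b c

/-- The curvature `ℛ_{ab}{}^C{}_D` of the unprimed spinor connection. -/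
def curv (a b : Idx) (C D : Fin 2) : R :=
  s.d a (s.Γ b C D) - s.d b (s.Γ a C D)
    + ∑ E, (s.Γ a C E * s.Γ b E D - s.Γ b C E * s.Γ a E D)
    - ∑ e, (s.γ a b e - s.γ b a e) * s.Γ e C D

/-- The curvature of the primed spinor connection. -/
def curv' (a b : Idx) (C D : Fin 2) : R :=
  s.d a (s.Γ' b C D) - s.d b (s.Γ' a C D)
    + ∑ E, (s.Γ' a C E * s.Γ' b E D - s.Γ' b C E * s.Γ' a E D)
    - ∑ e, (s.γ a b e - s.γ b a e) * s.Γ' e C D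

/-- The Riemann tensor `R_{abc}{}^d`. -/
def riem (a b c d : Idx) : R :=
  s.d a (s.γ b c d) - s.d b (s.γ a c d)
    + ∑ e, (s.γ b c e * s.γ a e d - s.γ a c e * s.γ b e d)
    - ∑ e, (s.γ a b e - s.γ b a e) * s.γ e c d

lemma sum_γ_mul (a b : Idx) (F : Idx → R) :
    ∑ e, s.γ a b e * F e =
      ∑ E, s.Γ a E b.1 * F (E, b.2) + ∑ E', s.Γ' a E' b.2 * F (b.1, E') :=
  sum_tensorConn_mul _ _ _ _ _

lemma curv_trace (a b : Idx) : s.curv a b 1 1 = -s.curv a b 0 0 := by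
  simp only [curv, Fin.sum_univ_two, s.trace_eq, map_neg, mul_neg, Finset.sum_neg_distrib]
  ring

lemma curv'_trace (a b : Idx) : s.curv' a b 1 1 = -s.curv' a b 0 0 := by
  simp only [curv', Fin.sum_univ_two, s.trace_eq', map_neg, mul_neg, Finset.sum_neg_distrib]
  ring

lemma riem_eq (a b : Idx) (C C' D D' : Fin 2) : s.riem a b (C, C') (D, D') =
    (if C' = D' then s.curv a b D C else 0) + (if C = D then s.curv' a b D' C' else 0) := by
  simp only [riem, curv, curv', Finset.sum_sub_distrib, sum_γ_mul]
  fin_cases C <;> fin_cases C' <;> fin_cases D <;> fin_cases D' <;>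
    simp [γ, tensorConn, s.trace_eq, s.trace_eq', mul_add, sub_mul, Finset.sum_add_distrib] <;>
    ring

/-- The covariant Hessian of a function. -/
def hess (a b : Idx) (f : R) : R := s.d a (s.d b f) - ∑ e, s.γ a b e * s.d e f

lemma hess_symm (a b : Idx) (f : R) : s.hess a b f = s.hess b a f := by
  have h := s.torsion_eq a b f
  simp only [sub_mul, Finset.sum_sub_distrib] at h
  simp only [hess, γ]
  linear_combination h

lemma sum_riem_mul (a b c : Idx) (f : R) : ∑ e, s.riem a b c e * s.d e f =
    -(s.d a (s.hess b c f) - s.d b (s.hess a c f) - ∑ e, (s.γ a b e - s.γ b a e) * s.hess e c f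
      - ∑ e, s.γ a c e * s.hess b e f + ∑ e, s.γ b c e * s.hess a e f) := by
  have h := s.torsion_eq a b (s.d c f)
  simp only [hess, riem, map_sub, map_sum, Derivation.leibniz, smul_eq_mul]
  simp only [γ, Fintype.sum_prod_type, Fin.sum_univ_two] at h ⊢
  linear_combination h

/-- The first Bianchi identity. -/
lemma riem_cyclic (hsep : ∀ v : Idx → R, (∀ f, ∑ e, v e * s.d e f = 0) → v = 0)
    (a b c e : Idx) : s.riem a b c e + s.riem b c a e + s.riem c a b e = 0 := by
  refine congrFun (hsep (fun e ↦ s.riem a b c e + s.riem b c a e + s.riem c a b e)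
    fun f ↦ ?_) e
  simp only [add_mul, Finset.sum_add_distrib, sum_riem_mul]
  rw [s.hess_symm c b, s.hess_symm c a, s.hess_symm b a]
  simp only [sub_mul, Finset.sum_sub_distrib]
  have h : ∀ p q r : Idx, ∑ e, s.γ p q e * s.hess r e f = ∑ e, s.γ p q e * s.hess e r f :=
    fun p q r ↦ Finset.sum_congr rfl fun e _ ↦ by rw [s.hess_symm]
  simp only [h]
  ring

end SpinFrame
end Algebra
end TwoSpinor
end

noncomputable section

namespace TwoSpinor
namespace SpinFrame

/-! ## Change of the unprimed spin frame -/

section Rotation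

variable {R : Type*} [CommRing R] (s : SpinFrame R) (G : Fin 2 → Fin 2 → R)

/-- The frame derivations `G^B{}_A ∂_{BA'}`. -/
def rotD (a : Idx) : Derivation ℤ R R := ∑ B, G B a.1 • s.d (B, a.2)

lemma rotD_apply (a : Idx) (f : R) :
    s.rotD G a f = G 0 a.1 * s.d (0, a.2) f + G 1 a.1 * s.d (1, a.2) f := by
  simp [rotD, Fin.sum_univ_two]

/-- The covariant derivatives of the new frame spinors, along the new frame derivations. -/
def rotW (a : Idx) (C D : Fin 2) : R :=
  s.rotD G a (G C D) + ∑ B, G B a.1 * ∑ F, s.Γ (B, a.2) C F * G F D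

lemma rotW_eq (a : Idx) (C D : Fin 2) : s.rotW G a C D =
    s.rotD G a (G C D) + ∑ B, G B a.1 * ∑ F, s.Γ (B, a.2) C F * G F D := rfl

/-- The unprimed connection in the new frame. -/
def rotΓ (a : Idx) (C D : Fin 2) : R :=
  ![G 1 1 * s.rotW G a 0 D - G 0 1 * s.rotW G a 1 D,
    G 0 0 * s.rotW G a 1 D - G 1 0 * s.rotW G a 0 D] C

/-- The primed connection along the new frame derivations. -/
def rotΓ' (a : Idx) (C D : Fin 2) : R := ∑ B, G B a.1 * s.Γ' (B, a.2) C D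

variable {G}

lemma sum_mul_rotΓ (hG : G 0 0 * G 1 1 - G 0 1 * G 1 0 = 1)
    (a : Idx) (C D : Fin 2) : ∑ F, G C F * s.rotΓ G a F D = s.rotW G a C D := by
  fin_cases C <;> simp [rotΓ, Fin.sum_univ_two]
  · linear_combination s.rotW G a 0 D * hG
  · linear_combination s.rotW G a 1 D * hG

lemma rotΓ_trace (hG : G 0 0 * G 1 1 - G 0 1 * G 1 0 = 1)
    (a : Idx) : s.rotΓ G a 1 1 = -s.rotΓ G a 0 0 := by
  have h := congrArg (s.rotD G a) hG
  simp only [map_sub, Derivation.leibniz, smul_eq_mul, Derivation.map_one_eq_zero] at h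
  simp only [rotΓ, rotW, Fin.sum_univ_two, s.trace_eq]
  simp
  linear_combination h

lemma rotΓ'_trace (a : Idx) : s.rotΓ' G a 1 1 = -s.rotΓ' G a 0 0 := by
  simp [rotΓ', s.trace_eq']

lemma rot_torsion (hG : G 0 0 * G 1 1 - G 0 1 * G 1 0 = 1)
    (a b : Idx) (f : R) :
    s.rotD G a (s.rotD G b f) - s.rotD G b (s.rotD G a f) =
      ∑ e, (tensorConn (s.rotΓ G) (s.rotΓ' G) a b e - tensorConn (s.rotΓ G) (s.rotΓ' G) b a e) *
        s.rotD G e f := by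
  have h : ∀ A B : Fin 2, _ := fun A B ↦ s.torsion_eq (A, a.2) (B, b.2) f
  have hab : ∀ C, _ := fun C ↦ s.sum_mul_rotΓ hG a C b.1
  have hba : ∀ C, _ := fun C ↦ s.sum_mul_rotΓ hG b C a.1
  simp only [sub_mul, Finset.sum_sub_distrib, sum_tensorConn_mul] at h ⊢
  simp only [rotW, Fin.sum_univ_two] at h hab hba ⊢
  simp only [rotD_apply, map_add, Derivation.leibniz, smul_eq_mul, rotΓ', Fin.sum_univ_two]
    at h hab hba ⊢
  linear_combination G 0 a.1 * G 0 b.1 * h 0 0 + G 0 a.1 * G 1 b.1 * h 0 1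
    + G 1 a.1 * G 0 b.1 * h 1 0 + G 1 a.1 * G 1 b.1 * h 1 1
    - s.d (0, b.2) f * hab 0 - s.d (1, b.2) f * hab 1
    + s.d (0, a.2) f * hba 0 + s.d (1, a.2) f * hba 1

/-- The spinor connection in the frame obtained by applying `G` to the unprimed frame spinors. -/
def rotate (hG : G 0 0 * G 1 1 - G 0 1 * G 1 0 = 1) : SpinFrame R where
  d := s.rotD G
  Γ := s.rotΓ G
  Γ' := s.rotΓ' G
  trace_eq := s.rotΓ_trace hG
  trace_eq' := s.rotΓ'_trace
  torsion_eq := s.rot_torsion hG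

lemma rotΓ_second (hG : G 0 0 * G 1 1 - G 0 1 * G 1 0 = 1)
    (a b : Idx) (C D : Fin 2) :
    ∑ F, G C F * (s.rotD G a (s.rotΓ G b F D) + ∑ E, s.rotΓ G a F E * s.rotΓ G b E D) =
      s.rotD G a (s.rotW G b C D)
        + ∑ B, G B a.1 * ∑ F, s.Γ (B, a.2) C F * s.rotW G b F D := by
  have h := congrArg (s.rotD G a) (s.sum_mul_rotΓ hG b C D)
  have ha : ∀ F, _ := fun F ↦ s.sum_mul_rotΓ hG a C F
  have hb : ∀ F, _ := fun F ↦ s.sum_mul_rotΓ hG b F D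
  have hW : ∀ F, _ := fun F ↦ s.rotW_eq G a C F
  simp only [Fin.sum_univ_two, map_add, Derivation.leibniz, smul_eq_mul] at h ha hb hW ⊢
  linear_combination h + s.rotΓ G b 0 D * ha 0 + s.rotΓ G b 1 D * ha 1
    + s.rotΓ G b 0 D * hW 0 + s.rotΓ G b 1 D * hW 1
    + (G 0 a.1 * s.Γ (0, a.2) C 0 + G 1 a.1 * s.Γ (1, a.2) C 0) * hb 0
    + (G 0 a.1 * s.Γ (0, a.2) C 1 + G 1 a.1 * s.Γ (1, a.2) C 1) * hb 1

lemma rotΓ_conn (hG : G 0 0 * G 1 1 - G 0 1 * G 1 0 = 1)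
    (a b : Idx) (C D : Fin 2) :
    ∑ F, G C F * ∑ e, (s.rotate hG).γ a b e * s.rotΓ G e F D =
      ∑ B, s.rotW G a B b.1 * (s.d (B, b.2) (G C D) + ∑ F, s.Γ (B, b.2) C F * G F D)
      + ∑ E', s.rotΓ' G a E' b.2 * s.rotW G (b.1, E') C D := by
  have ha : ∀ B, _ := fun B ↦ s.sum_mul_rotΓ hG a B b.1
  have hE : ∀ E, _ := fun E ↦ s.sum_mul_rotΓ hG (E, b.2) C D
  have hE' : ∀ E, _ := fun E ↦ s.sum_mul_rotΓ hG (b.1, E) C D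
  have hW : ∀ E, _ := fun E ↦ s.rotW_eq G (E, b.2) C D
  simp only [sum_γ_mul, rotate]
  simp only [Fin.sum_univ_two, rotD_apply] at ha hE hE' hW ⊢
  linear_combination
    s.rotΓ G a 0 b.1 * (hE 0 + hW 0) + s.rotΓ G a 1 b.1 * (hE 1 + hW 1)
    + s.rotΓ' G a 0 b.2 * hE' 0 + s.rotΓ' G a 1 b.2 * hE' 1
    + (s.d (0, b.2) (G C D) + (s.Γ (0, b.2) C 0 * G 0 D + s.Γ (0, b.2) C 1 * G 1 D)) * ha 0
    + (s.d (1, b.2) (G C D) + (s.Γ (1, b.2) C 0 * G 0 D + s.Γ (1, b.2) C 1 * G 1 D)) * ha 1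

/-- The curvature transforms tensorially under a change of spin frame. -/
lemma sum_mul_rotate_curv (hG : G 0 0 * G 1 1 - G 0 1 * G 1 0 = 1)
    (a b : Idx) (C D : Fin 2) :
    ∑ F, G C F * (s.rotate hG).curv a b F D =
      ∑ A, ∑ B, G A a.1 * G B b.1 * ∑ F, s.curv (A, a.2) (B, b.2) C F * G F D := by
  have h1 := s.rotΓ_second hG a b C D
  have h2 := s.rotΓ_second hG b a C D
  have h3 := s.rotΓ_conn hG a b C D
  have h4 := s.rotΓ_conn hG b a C D
  have h : ∀ A B : Fin 2, _ := fun A B ↦ s.torsion_eq (A, a.2) (B, b.2) (G C D)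
  have hL : ∑ F, G C F * (s.rotate hG).curv a b F D =
    ∑ F, G C F * (s.rotD G a (s.rotΓ G b F D) + ∑ E, s.rotΓ G a F E * s.rotΓ G b E D)
    - ∑ F, G C F * (s.rotD G b (s.rotΓ G a F D) + ∑ E, s.rotΓ G b F E * s.rotΓ G a E D)
    - (∑ F, G C F * ∑ e, (s.rotate hG).γ a b e * s.rotΓ G e F D
      - ∑ F, G C F * ∑ e, (s.rotate hG).γ b a e * s.rotΓ G e F D) := by
    simp only [curv, sub_mul, ← Finset.sum_sub_distrib, ← mul_sub]
    refine Finset.sum_congr rfl fun F _ ↦ ?_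
    simp only [rotate, Finset.sum_sub_distrib]
    ring
  rw [hL, h1, h2, h3, h4]
  simp only [sub_mul, Finset.sum_sub_distrib, sum_tensorConn_mul] at h
  simp only [curv, sub_mul, Finset.sum_sub_distrib, sum_γ_mul]
  simp only [rotW, Fin.sum_univ_two] at h ⊢
  simp only [rotD_apply, map_add, Derivation.leibniz, smul_eq_mul, rotΓ', Fin.sum_univ_two]
    at h ⊢
  linear_combination G 0 a.1 * G 0 b.1 * h 0 0 + G 0 a.1 * G 1 b.1 * h 0 1
    + G 1 a.1 * G 0 b.1 * h 1 0 + G 1 a.1 * G 1 b.1 * h 1 1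

end Rotation
end SpinFrame
end TwoSpinor
end

noncomputable section

namespace TwoSpinor
namespace SpinFrame

/-! ## The projected Killing spinor equation -/

section Killing

variable {R : Type*} [CommRing R] (s : SpinFrame R)

/-- `∇_a K_{BC}`. -/
def nab (a : Idx) (K : Fin 2 → Fin 2 → R) (B C : Fin 2) : R :=
  s.d a (K B C) - ∑ D, s.Γ a D B * K D C - ∑ D, s.Γ a D C * K B D

/-- Six times the symmetrized derivative `∇_{A'(A} K_{BC)}`. -/
def symNab (A' : Fin 2) (K : Fin 2 → Fin 2 → R) (A B C : Fin 2) : R :=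
  s.nab (A, A') K B C + s.nab (A, A') K C B + s.nab (B, A') K A C + s.nab (B, A') K C A
    + s.nab (C, A') K A B + s.nab (C, A') K B A

/-- The components `K_{BC}` in the frame changed by `G`. -/
def rotK (G K : Fin 2 → Fin 2 → R) (A B : Fin 2) : R := ∑ C, ∑ D, G C A * G D B * K C D

variable {G : Fin 2 → Fin 2 → R}

lemma rotate_nab (hG : G 0 0 * G 1 1 - G 0 1 * G 1 0 = 1) (K : Fin 2 → Fin 2 → R)
    (A A' B C : Fin 2) :
    (s.rotate hG).nab (A, A') (rotK G K) B C =
      ∑ P, ∑ Q, ∑ T, G P A * G Q B * G T C * s.nab (P, A') K Q T := by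
  have h : ∀ Q D, _ := fun Q D ↦ (s.sum_mul_rotΓ hG (A, A') Q D).trans (s.rotW_eq G (A, A') Q D)
  simp only [nab, rotK, rotate, Fin.sum_univ_two, map_add, Derivation.leibniz, smul_eq_mul,
    rotD_apply] at h ⊢
  linear_combination
    - (G 0 C * K 0 0 + G 1 C * K 0 1) * h 0 B - (G 0 C * K 1 0 + G 1 C * K 1 1) * h 1 B
    - (G 0 B * K 0 0 + G 1 B * K 1 0) * h 0 C - (G 0 B * K 0 1 + G 1 B * K 1 1) * h 1 C

lemma rotate_symNab_eq_zero (hG : G 0 0 * G 1 1 - G 0 1 * G 1 0 = 1) {K : Fin 2 → Fin 2 → R}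
    {A' : Fin 2} (hK : ∀ B C, ∑ A, G A 0 * s.symNab A' K A B C = 0) (B C : Fin 2) :
    (s.rotate hG).symNab A' (rotK G K) 0 B C = 0 := by
  simp only [symNab, rotate_nab, Fin.sum_univ_two] at hK ⊢
  linear_combination G 0 B * G 0 C * hK 0 0 + G 0 B * G 1 C * hK 0 1
    + G 1 B * G 0 C * hK 1 0 + G 1 B * G 1 C * hK 1 1

lemma rotK_symm {K : Fin 2 → Fin 2 → R} (hK : ∀ A B, K A B = K B A) (A B : Fin 2) :
    rotK G K A B = rotK G K B A := by
  simp only [rotK, Fin.sum_univ_two, hK 1 0]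
  ring

lemma eq_zero_of_rotK (hG : G 0 0 * G 1 1 - G 0 1 * G 1 0 = 1) {K : Fin 2 → Fin 2 → R}
    (h : ∀ A B, rotK G K A B = 0) (A B : Fin 2) : K A B = 0 := by
  let J : Fin 2 → Fin 2 → R := ![![G 1 1, -G 0 1], ![-G 1 0, G 0 0]]
  have hJ : ∀ P Q, ∑ C, J C P * G Q C = if P = Q then 1 else 0 := by
    intro P Q
    fin_cases P <;> fin_cases Q <;> simp [J, Fin.sum_univ_two] <;>
      first | ring1 | linear_combination hG
  have h2 : ∑ C, ∑ D, J C A * J D B * rotK G K C D = 0 := by simp [h]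
  have h3 : ∑ C, ∑ D, J C A * J D B * rotK G K C D =
      ∑ P, ∑ Q, (∑ C, J C A * G P C) * (∑ D, J D B * G Q D) * K P Q := by
    simp only [rotK, Fin.sum_univ_two]
    ring
  rw [h3] at h2
  simpa [hJ] using h2

lemma rotate_shear (hG : G 0 0 * G 1 1 - G 0 1 * G 1 0 = 1) {A' : Fin 2} {l : Fin 2 → R}
    (hl0 : l 0 = -G 1 0) (hl1 : l 1 = G 0 0)
    (h : ∑ A, ∑ B, G A 0 * G B 0 * (s.d (A, A') (l B) - ∑ C, s.Γ (A, A') C B * l C) = 0) :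
    (s.rotate hG).Γ (0, A') 1 0 = 0 := by
  simp only [rotate, rotΓ, rotW, rotD_apply, Fin.sum_univ_two, hl0, hl1, map_neg, s.trace_eq]
    at h ⊢
  simp
  linear_combination -h

/-- The exterior derivative, along the leaves spanned by `∂_{0A'}`, of the leafwise one-form `θ`. -/
def leafExt (θ : Fin 2 → R) : R :=
  s.d (0, 0) (θ 1) - s.d (0, 1) (θ 0) - (s.Γ (0, 0) 0 0 * θ 1 - s.Γ (0, 1) 0 0 * θ 0
    + ∑ E', (s.Γ' (0, 0) E' 1 - s.Γ' (0, 1) E' 0) * θ E')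

lemma leafExt_add (θ ζ : Fin 2 → R) : s.leafExt (θ + ζ) = s.leafExt θ + s.leafExt ζ := by
  simp only [leafExt, Pi.add_apply, map_add, Fin.sum_univ_two]
  ring

lemma leafExt_sub (θ ζ : Fin 2 → R) : s.leafExt (θ - ζ) = s.leafExt θ - s.leafExt ζ := by
  simp only [leafExt, Pi.sub_apply, map_sub, Fin.sum_univ_two]
  ring

variable {s}

/-- Integrability condition for `∂_{0A'} k = θ_{A'} k`. -/
lemma leafExt_mul_eq_zero (hs : ∀ A', s.Γ (0, A') 1 0 = 0) {θ : Fin 2 → R} {k : R}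
    (h : ∀ A', s.d (0, A') k = θ A' * k) : s.leafExt θ * k = 0 := by
  have ht := s.torsion_eq (0, 0) (0, 1) k
  simp only [sub_mul, Finset.sum_sub_distrib, sum_tensorConn_mul, Fin.sum_univ_two, hs, h,
    Derivation.leibniz, smul_eq_mul] at ht
  simp only [leafExt, Fin.sum_univ_two]
  linear_combination ht

lemma leafExt_expansion (hs : ∀ A', s.Γ (0, A') 1 0 = 0) :
    s.leafExt (fun A' ↦ s.Γ (0, A') 0 0) = s.curv (0, 0) (0, 1) 0 0 := by
  simp only [leafExt, curv, sub_mul, Finset.sum_sub_distrib, sum_γ_mul, Fin.sum_univ_two, hs]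
  ring

lemma leafExt_twist (hs : ∀ A', s.Γ (0, A') 1 0 = 0) :
    s.leafExt (fun A' ↦ s.Γ (1, A') 1 0) =
      s.curv (0, 0) (1, 1) 1 0 - s.curv (0, 1) (1, 0) 1 0 := by
  simp only [leafExt, curv, sub_mul, Finset.sum_sub_distrib, sum_γ_mul, Fin.sum_univ_two, hs,
    s.trace_eq, map_zero]
  ring

/-- Triviality of the solutions of the projected Killing spinor equation in an adapted frame. -/
lemma eq_zero_of_symNab_eq_zero (h6 : ∀ k : R, 6 * k = 0 → k = 0)
    (hs : ∀ A', s.Γ (0, A') 1 0 = 0)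
    (hcurv : s.curv (0, 0) (1, 1) 1 0 - s.curv (0, 1) (1, 0) 1 0 = -2 * s.curv (0, 0) (0, 1) 0 0)
    (hreg : ∀ k, s.curv (0, 0) (0, 1) 0 0 * k = 0 → k = 0)
    {K : Fin 2 → Fin 2 → R} (hsymm : ∀ A B, K A B = K B A)
    (hK : ∀ A' B C, s.symNab A' K 0 B C = 0) (A B : Fin 2) : K A B = 0 := by
  set μ : Fin 2 → R := fun A' ↦ s.Γ (0, A') 0 0 with hμ
  set ν : Fin 2 → R := fun A' ↦ s.Γ (1, A') 1 0 with hν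
  have eμ := leafExt_expansion hs
  have eν := (leafExt_twist hs).trans hcurv
  have h00 : K 0 0 = 0 := by
    refine hreg _ (h6 _ ?_)
    have h := leafExt_mul_eq_zero hs (θ := μ + μ) (k := K 0 0) fun A' ↦ by
      have := hK A' 0 0
      simp only [symNab, nab, Fin.sum_univ_two, hs] at this
      refine sub_eq_zero.1 (h6 _ ?_)
      simp only [hμ, Pi.add_apply]
      linear_combination this
    rw [leafExt_add, eμ] at h
    linear_combination 3 * h
  have h01 : K 0 1 = 0 := by
    refine hreg _ (h6 _ ?_)
    have h := leafExt_mul_eq_zero hs (θ := ν) (k := K 0 1) fun A' ↦ by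
      have := hK A' 0 1
      simp only [symNab, nab, Fin.sum_univ_two, hs, hsymm 1 0, h00, map_zero, s.trace_eq] at this
      refine sub_eq_zero.1 (h6 _ (h6 _ ?_))
      simp only [hν]
      linear_combination 9 * this
    rw [eν] at h
    linear_combination -3 * h
  have h11 : K 1 1 = 0 := by
    refine hreg _ (h6 _ ?_)
    have h := leafExt_mul_eq_zero hs (θ := ν + ν - (μ + μ)) (k := K 1 1) fun A' ↦ by
      have := hK A' 1 1
      simp only [symNab, nab, Fin.sum_univ_two, hsymm 1 0, h00, h01, map_zero, s.trace_eq] at this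
      refine sub_eq_zero.1 (h6 _ ?_)
      simp only [hν, hμ, Pi.add_apply, Pi.sub_apply]
      linear_combination 3 * this
    rw [leafExt_sub, leafExt_add, leafExt_add, eν, eμ] at h
    linear_combination -h
  fin_cases A <;> fin_cases B
  exacts [h00, h01, (hsymm 1 0).trans h01, h11]

end Killing
end SpinFrame
end TwoSpinor
end

noncomputable section

namespace TwoSpinor
namespace SpinStructure

open Set Filter Topology VectorField

variable {M : Type*} [TopologicalSpace M] [ChartedSpace (EuclideanSpace ℝ (Fin 4)) M]
  [IsManifold (𝓡 4) ∞ M] {g : LorentzMetric M} (S : SpinStructure g)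

/-! ## Frame derivatives of smooth functions -/

lemma contMDiff_frameRe (a : Idx) : ContMDiff (𝓡 4) (𝓡 4).tangent ∞
    (fun x ↦ (⟨x, S.frameRe a x⟩ : TangentBundle (𝓡 4) M)) :=
  S.contMDiff_solder _

lemma contMDiff_frameIm (a : Idx) : ContMDiff (𝓡 4) (𝓡 4).tangent ∞
    (fun x ↦ (⟨x, S.frameIm a x⟩ : TangentBundle (𝓡 4) M)) :=
  S.contMDiff_solder _

lemma pd_congr {a : Idx} {f h : M → ℂ} {x : M} (hfh : f =ᶠ[𝓝 x] h) :
    S.pd a f x = S.pd a h x := by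
  have : mvfderiv (𝓡 4) f x = (mvfderiv (𝓡 4) h x : EuclideanSpace ℝ (Fin 4) →L[ℝ] ℂ) :=
    hfh.mfderiv_eq
  simp only [pd]
  rw [this]

omit [IsManifold (𝓡 4) ∞ M] in
lemma mvfderiv_complex_add {f h : M → ℂ} {x : M} (hf : MDifferentiableAt (𝓡 4) 𝓘(ℝ, ℂ) f x)
    (hh : MDifferentiableAt (𝓡 4) 𝓘(ℝ, ℂ) h x) (v : TangentSpace (𝓡 4) x) :
    mvfderiv (𝓡 4) (f + h) x v = mvfderiv (𝓡 4) f x v + mvfderiv (𝓡 4) h x v := by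
  rw [mvfderiv_add hf hh]; rfl

omit [IsManifold (𝓡 4) ∞ M] in
lemma mvfderiv_complex_mul {f h : M → ℂ} {x : M} (hf : MDifferentiableAt (𝓡 4) 𝓘(ℝ, ℂ) f x)
    (hh : MDifferentiableAt (𝓡 4) 𝓘(ℝ, ℂ) h x) (v : TangentSpace (𝓡 4) x) :
    mvfderiv (𝓡 4) (f * h) x v = f x * mvfderiv (𝓡 4) h x v + h x * mvfderiv (𝓡 4) f x v :=
  congrArg (fun L : EuclideanSpace ℝ (Fin 4) →L[ℝ] ℂ ↦ L v)
    (hf.hasMFDerivAt.mul hh.hasMFDerivAt).mfderiv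

omit [IsManifold (𝓡 4) ∞ M] in
lemma mvfderiv_complex_const_mul {f : M → ℂ} {x : M} (c : ℂ)
    (hf : MDifferentiableAt (𝓡 4) 𝓘(ℝ, ℂ) f x) (v : TangentSpace (𝓡 4) x) :
    mvfderiv (𝓡 4) (fun y ↦ c * f y) x v = c * mvfderiv (𝓡 4) f x v := by
  have h := mvfderiv_complex_mul (f := fun _ : M ↦ c) mdifferentiableAt_const hf v
  rw [mvfderiv_const] at h
  simpa using! h

lemma pd_add {a : Idx} {f h : M → ℂ} {x : M} (hf : MDifferentiableAt (𝓡 4) 𝓘(ℝ, ℂ) f x)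
    (hh : MDifferentiableAt (𝓡 4) 𝓘(ℝ, ℂ) h x) :
    S.pd a (f + h) x = S.pd a f x + S.pd a h x := by
  simp only [pd, mvfderiv_complex_add hf hh]
  ring

lemma pd_mul {a : Idx} {f h : M → ℂ} {x : M} (hf : MDifferentiableAt (𝓡 4) 𝓘(ℝ, ℂ) f x)
    (hh : MDifferentiableAt (𝓡 4) 𝓘(ℝ, ℂ) h x) :
    S.pd a (f * h) x = f x * S.pd a h x + h x * S.pd a f x := by
  simp only [pd, mvfderiv_complex_mul hf hh]
  ring

variable {U : Set M}

omit [IsManifold (𝓡 4) ∞ M] in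
lemma contMDiffOn_complex_mul {f h : M → ℂ} (hf : ContMDiffOn (𝓡 4) 𝓘(ℝ, ℂ) ∞ f U)
    (hh : ContMDiffOn (𝓡 4) 𝓘(ℝ, ℂ) ∞ h U) : ContMDiffOn (𝓡 4) 𝓘(ℝ, ℂ) ∞ (f * h) U :=
  (contDiff_mul (𝕜 := ℝ) (𝔸 := ℂ) (n := ∞)).contMDiff.comp_contMDiffOn (hf.prodMk_space hh)

lemma contMDiffOn_pd (hU : IsOpen U) {f : M → ℂ} (hf : ContMDiffOn (𝓡 4) 𝓘(ℝ, ℂ) ∞ f U)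
    (a : Idx) : ContMDiffOn (𝓡 4) 𝓘(ℝ, ℂ) ∞ (S.pd a f) U :=
  (hf.mvfderiv_apply hU (S.contMDiff_frameRe a)).add
    (contMDiffOn_complex_mul contMDiffOn_const (hf.mvfderiv_apply hU (S.contMDiff_frameIm a)))

/-- A real tangent vector acts on functions through its spinor components. -/
lemma mvfderiv_eq_sum_comp (f : M → ℂ) (x : M) (v : TangentSpace (𝓡 4) x) :
    mvfderiv (𝓡 4) f x v = ∑ c, S.comp x v c * S.pd c f x := by
  set V := (S.solder x).symm v with hV
  have hv : v = S.solder x V := by simp [hV]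
  have hsum : V.1 = ∑ c : Idx, V.1 c.1 c.2 • Matrix.single c.1 c.2 (1 : ℂ) := by
    conv_lhs => rw [Matrix.matrix_eq_sum_single V.1]
    rw [Fintype.sum_prod_type]
    simp [Matrix.smul_single]
  have hre : V = ∑ c : Idx, ((V.1 c.1 c.2).re • realPart (Matrix.single c.1 c.2 (1 : ℂ))
      - (V.1 c.1 c.2).im • imaginaryPart (Matrix.single c.1 c.2 (1 : ℂ))) := by
    have h := congrArg realPart hsum
    rw [selfAdjoint.realPart_coe, map_sum] at h
    simpa only [realPart_smul] using h
  have him : (0 : HermBispinor) =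
      ∑ c : Idx, ((V.1 c.1 c.2).re • imaginaryPart (Matrix.single c.1 c.2 (1 : ℂ))
      + (V.1 c.1 c.2).im • realPart (Matrix.single c.1 c.2 (1 : ℂ))) := by
    have h := congrArg imaginaryPart hsum
    rw [selfAdjoint.imaginaryPart_coe, map_sum] at h
    simpa only [imaginaryPart_smul] using h
  set L : HermBispinor →ₗ[ℝ] ℂ :=
    (mvfderiv (𝓡 4) f x).toLinearMap ∘ₗ (S.solder x).toLinearMap with hL
  have h1 := congrArg L hre
  have h2 := congrArg L him
  simp only [map_sum, map_sub, map_add, map_smul, map_zero, Complex.real_smul] at h1 h2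
  have h3 : mvfderiv (𝓡 4) f x v = L V := by rw [hv]; rfl
  rw [h3, h1, ← add_zero (∑ c : Idx, _), ← mul_zero Complex.I, h2, Finset.mul_sum,
    ← Finset.sum_add_distrib]
  refine Finset.sum_congr rfl fun c _ ↦ ?_
  have h4 : S.pd c f x = L (realPart (Matrix.single c.1 c.2 (1 : ℂ)))
    + Complex.I * L (imaginaryPart (Matrix.single c.1 c.2 (1 : ℂ))) := rfl
  have h5 : S.comp x v c = (V.1 c.1 c.2).re + (V.1 c.1 c.2).im * Complex.I :=
    (Complex.re_add_im _).symm
  rw [h4, h5]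
  linear_combination -(V.1 c.1 c.2).im * L (imaginaryPart (Matrix.single c.1 c.2 (1 : ℂ))) *
    Complex.I_sq

/-- The commutator of frame derivatives. -/
lemma pd_comm (hU : IsOpen U) {f : M → ℂ} (hf : ContMDiffOn (𝓡 4) 𝓘(ℝ, ℂ) ∞ f U)
    (a b : Idx) {x : M} (hx : x ∈ U) :
    S.pd a (S.pd b f) x - S.pd b (S.pd a f) x = ∑ c, S.bracket a b c x * S.pd c f x := by
  have hd : ∀ {h : M → ℂ}, ContMDiffOn (𝓡 4) 𝓘(ℝ, ℂ) ∞ h U →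
      MDifferentiableAt (𝓡 4) 𝓘(ℝ, ℂ) h x := fun hh ↦
    (hh.contMDiffAt (hU.mem_nhds hx)).mdifferentiableAt (by simp)
  have hpd : ∀ (b : Idx) (v : TangentSpace (𝓡 4) x), mvfderiv (𝓡 4) (S.pd b f) x v =
      mvfderiv (𝓡 4) (fun y ↦ mvfderiv (𝓡 4) f y (S.frameRe b y)) x v +
      Complex.I * mvfderiv (𝓡 4) (fun y ↦ mvfderiv (𝓡 4) f y (S.frameIm b y)) x v := by
    intro b v
    have hRe := hd (hf.mvfderiv_apply hU (S.contMDiff_frameRe b))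
    have hIm := hf.mvfderiv_apply hU (S.contMDiff_frameIm b)
    rw [← mvfderiv_complex_const_mul _ (hd hIm)]
    exact mvfderiv_complex_add hRe (hd (contMDiffOn_complex_mul contMDiffOn_const hIm)) v
  have e1 := mvfderiv_mlieBracket hU hf (S.contMDiff_frameRe a) (S.contMDiff_frameRe b) hx
  have e2 := mvfderiv_mlieBracket hU hf (S.contMDiff_frameIm a) (S.contMDiff_frameIm b) hx
  have e3 := mvfderiv_mlieBracket hU hf (S.contMDiff_frameRe a) (S.contMDiff_frameIm b) hx
  have e4 := mvfderiv_mlieBracket hU hf (S.contMDiff_frameIm a) (S.contMDiff_frameRe b) hx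
  rw [S.mvfderiv_eq_sum_comp] at e1 e2 e3 e4
  have hb : ∑ c, S.bracket a b c x * S.pd c f x =
      ∑ c, S.comp x (mlieBracket (𝓡 4) (S.frameRe a) (S.frameRe b) x) c * S.pd c f x
      - ∑ c, S.comp x (mlieBracket (𝓡 4) (S.frameIm a) (S.frameIm b) x) c * S.pd c f x
      + Complex.I * (
        ∑ c, S.comp x (mlieBracket (𝓡 4) (S.frameRe a) (S.frameIm b) x) c * S.pd c f x
        + ∑ c, S.comp x (mlieBracket (𝓡 4) (S.frameIm a) (S.frameRe b) x) c * S.pd c f x) := by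
    rw [← Finset.sum_sub_distrib, ← Finset.sum_add_distrib, Finset.mul_sum,
      ← Finset.sum_add_distrib]
    refine Finset.sum_congr rfl fun c _ ↦ ?_
    simp only [bracket]
    ring
  rw [hb, e1, e2, e3, e4]
  simp only [show ∀ (a : Idx) (h : M → ℂ), S.pd a h x = mvfderiv (𝓡 4) h x (S.frameRe a x)
    + Complex.I * mvfderiv (𝓡 4) h x (S.frameIm a x) from fun _ _ ↦ rfl, hpd]
  linear_combination (mvfderiv (𝓡 4) (fun y ↦ mvfderiv (𝓡 4) f y (S.frameIm b y)) x (S.frameIm a x)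
    - mvfderiv (𝓡 4) (fun y ↦ mvfderiv (𝓡 4) f y (S.frameIm a y)) x (S.frameIm b x)) *
    Complex.I_sq

end SpinStructure
end TwoSpinor
end

noncomputable section

namespace TwoSpinor
namespace SpinStructure

open Set Filter Topology VectorField

variable {M : Type*} [TopologicalSpace M] [ChartedSpace (EuclideanSpace ℝ (Fin 4)) M]
  [IsManifold (𝓡 4) ∞ M] {g : LorentzMetric M} (S : SpinStructure g)

/-! ## Smoothness of the connection coefficients -/

lemma sum_gEps_mul_sum_gEps (c : Idx) (v : Idx → ℂ) :
    ∑ d, gEps c d * ∑ a, gEps a d * v a = v c := by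
  obtain ⟨C, C'⟩ := c
  simp only [Fintype.sum_prod_type, Fin.sum_univ_two]
  fin_cases C <;> fin_cases C' <;> simp [gEps, eps]

lemma comp_eq_metric (x : M) (v : TangentSpace (𝓡 4) x) (c : Idx) :
    S.comp x v c = ∑ d, gEps c d *
      (g.val x v (S.frameRe d x) + Complex.I * g.val x v (S.frameIm d x)) := by
  rw [← sum_gEps_mul_sum_gEps c (S.comp x v)]
  refine Finset.sum_congr rfl fun d _ ↦ ?_
  congr 1
  obtain ⟨V, rfl⟩ := (S.solder x).surjective v
  simp only [frameRe, frameIm, S.metric_solder, comp, LinearEquiv.symm_apply_apply]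
  rw [Finset.mul_sum, ← Finset.sum_add_distrib]
  refine Finset.sum_congr rfl fun a _ ↦ ?_
  have h : ∀ b : Idx, Matrix.single d.1 d.2 (1 : ℂ) b.1 b.2 =
      (realPart (Matrix.single d.1 d.2 (1 : ℂ))).1 b.1 b.2 +
      Complex.I * (imaginaryPart (Matrix.single d.1 d.2 (1 : ℂ))).1 b.1 b.2 := fun b ↦ by
    conv_lhs => rw [← realPart_add_I_smul_imaginaryPart (Matrix.single d.1 d.2 (1 : ℂ))]
    rfl
  have h2 : gEps a d * V.1 a.1 a.2 =
      ∑ b : Idx, gEps a b * V.1 a.1 a.2 * Matrix.single d.1 d.2 (1 : ℂ) b.1 b.2 := by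
    rw [Finset.sum_eq_single d]
    · simp
    · intro b _ hb
      rw [Matrix.single_apply_of_ne, mul_zero]
      rintro ⟨h1, h2⟩
      exact hb (Prod.ext h1.symm h2.symm)
    · simp
  rw [h2, Finset.mul_sum, ← Finset.sum_add_distrib]
  refine Finset.sum_congr rfl fun b _ ↦ ?_
  rw [h]
  ring

lemma contMDiff_metric_apply (g : LorentzMetric M) {X Y : Π x : M, TangentSpace (𝓡 4) x}
    (hX : ContMDiff (𝓡 4) (𝓡 4).tangent ∞ (fun x ↦ (⟨x, X x⟩ : TangentBundle (𝓡 4) M)))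
    (hY : ContMDiff (𝓡 4) (𝓡 4).tangent ∞ (fun x ↦ (⟨x, Y x⟩ : TangentBundle (𝓡 4) M))) :
    ContMDiff (𝓡 4) 𝓘(ℝ, ℝ) ∞ (fun x ↦ g.val x (X x) (Y x)) := by
  intro x
  have : ContMDiffAt (𝓡 4) ((𝓡 4).prod 𝓘(ℝ)) ∞
      (fun m ↦ Bundle.TotalSpace.mk' ℝ (E := Bundle.Trivial M ℝ) m (g.val m (X m) (Y m))) x := by
    apply ContMDiffAt.clm_bundle_apply₂ (F₁ := EuclideanSpace ℝ (Fin 4))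
      (F₂ := EuclideanSpace ℝ (Fin 4))
    · exact g.contMDiff x
    · exact hX x
    · exact hY x
  simp only [Bundle.contMDiffAt_totalSpace] at this
  exact this.2

omit [IsManifold (𝓡 4) ∞ M] in
lemma contMDiff_const_mul (z : ℂ) {f : M → ℂ} (hf : ContMDiff (𝓡 4) 𝓘(ℝ, ℂ) ∞ f) :
    ContMDiff (𝓡 4) 𝓘(ℝ, ℂ) ∞ (fun x ↦ z * f x) :=
  (contDiff_const.mul contDiff_id : ContDiff ℝ ∞ fun w : ℂ ↦ z * w).contMDiff.comp hf

lemma contMDiff_comp {X : Π x : M, TangentSpace (𝓡 4) x}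
    (hX : ContMDiff (𝓡 4) (𝓡 4).tangent ∞ (fun x ↦ (⟨x, X x⟩ : TangentBundle (𝓡 4) M)))
    (c : Idx) : ContMDiff (𝓡 4) 𝓘(ℝ, ℂ) ∞ (fun x ↦ S.comp x (X x) c) := by
  simp only [S.comp_eq_metric]
  have hof : ∀ {f : M → ℝ}, ContMDiff (𝓡 4) 𝓘(ℝ, ℝ) ∞ f →
      ContMDiff (𝓡 4) 𝓘(ℝ, ℂ) ∞ (fun x ↦ (f x : ℂ)) := fun hf ↦
    Complex.ofRealCLM.contDiff.contMDiff.comp hf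
  refine contMDiff_finsetSum fun d _ ↦ contMDiff_const_mul _ ?_
  exact (hof (contMDiff_metric_apply g hX (S.contMDiff_frameRe d))).add
    (contMDiff_const_mul _ (hof (contMDiff_metric_apply g hX (S.contMDiff_frameIm d))))

lemma contMDiff_bracket (a b c : Idx) : ContMDiff (𝓡 4) 𝓘(ℝ, ℂ) ∞ (S.bracket a b c) := by
  have hbr : ∀ {X Y : Π x : M, TangentSpace (𝓡 4) x},
      ContMDiff (𝓡 4) (𝓡 4).tangent ∞ (fun x ↦ (⟨x, X x⟩ : TangentBundle (𝓡 4) M)) →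
      ContMDiff (𝓡 4) (𝓡 4).tangent ∞ (fun x ↦ (⟨x, Y x⟩ : TangentBundle (𝓡 4) M)) →
      ContMDiff (𝓡 4) 𝓘(ℝ, ℂ) ∞ (fun x ↦ S.comp x (mlieBracket (𝓡 4) X Y x) c) := by
    intro X Y hX hY
    refine S.contMDiff_comp (fun x ↦ ?_) c
    have : IsManifold (𝓡 4) (((⊤ : ℕ∞) : WithTop ℕ∞) + 1) M := by simpa
    have : IsManifold (𝓡 4) (minSmoothness ℝ 2) M :=
      IsManifold.of_le (n := ∞) (by simpa using! WithTop.coe_le_coe.2 (le_top : (2 : ℕ∞) ≤ ⊤))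
    exact ContMDiffAt.mlieBracket_vectorField (m := ⊤) (n := ⊤) (hX x) (hY x) (by simp)
  have hR := S.contMDiff_frameRe
  have hI := S.contMDiff_frameIm
  exact ((hbr (hR a) (hR b)).sub (hbr (hI a) (hI b))).add
    (contMDiff_const_mul _ ((hbr (hR a) (hI b)).add (hbr (hI a) (hR b))))

lemma contMDiff_conn (a b c : Idx) : ContMDiff (𝓡 4) 𝓘(ℝ, ℂ) ∞ (S.conn a b c) := by
  have hlow : ∀ a b c, ContMDiff (𝓡 4) 𝓘(ℝ, ℂ) ∞ (S.bracketLow a b c) := fun a b c ↦ by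
    unfold bracketLow
    refine contMDiff_finsetSum fun d _ ↦ ?_
    simp only [mul_comm (S.bracket a b d _)]
    exact contMDiff_const_mul _ (S.contMDiff_bracket a b d)
  unfold conn connLow
  exact contMDiff_finsetSum fun d _ ↦ contMDiff_const_mul _ (contMDiff_const_mul _
    (((hlow _ _ _).sub (hlow _ _ _)).sub (hlow _ _ _)))

/-! ## Algebraic properties of the connection coefficients -/

lemma bracket_swap (a b c : Idx) (x : M) : S.bracket a b c x = -S.bracket b a c x := by
  have hneg : ∀ v : TangentSpace (𝓡 4) x, S.comp x (-v) c = -S.comp x v c := fun v ↦ by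
    simp [comp]
  simp only [bracket]
  rw [mlieBracket_swap_apply (V := S.frameRe a) (W := S.frameRe b),
    mlieBracket_swap_apply (V := S.frameIm a) (W := S.frameIm b),
    mlieBracket_swap_apply (V := S.frameRe a) (W := S.frameIm b),
    mlieBracket_swap_apply (V := S.frameIm a) (W := S.frameRe b)]
  simp only [hneg]
  ring

lemma bracketLow_swap (a b c : Idx) (x : M) : S.bracketLow a b c x = -S.bracketLow b a c x := by
  simp only [bracketLow, S.bracket_swap a b, neg_mul, Finset.sum_neg_distrib]

lemma connLow_antisymm (a b c : Idx) (x : M) : S.connLow a b c x = -S.connLow a c b x := by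
  simp only [connLow]
  linear_combination (-1 / 2) * S.bracketLow_swap b c a x

lemma conn_sub_conn (a b c : Idx) (x : M) :
    S.conn a b c x - S.conn b a c x = S.bracket a b c x := by
  rw [← sum_gEps_mul_sum_gEps c (fun c ↦ S.bracket a b c x)]
  simp only [conn]
  rw [← Finset.sum_sub_distrib]
  refine Finset.sum_congr rfl fun d _ ↦ ?_
  have h : ∑ e, gEps e d * S.bracket a b e x = S.bracketLow a b d x :=
    Finset.sum_congr rfl fun e _ ↦ mul_comm _ _
  rw [h]
  simp only [connLow]
  linear_combination -gEps c d / 2 * S.bracketLow_swap b a d x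

/-- The coefficients of the connection on primed spinors. -/
def spinConn' (a : Idx) (B' C' : Fin 2) (x : M) : ℂ :=
  (1 / 2) * ∑ C, S.conn a (C, C') (C, B') x

lemma conn_eq_tensorConn (a b c : Idx) (x : M) : S.conn a b c x =
    tensorConn (fun a B C ↦ S.spinConn a B C x) (fun a B C ↦ S.spinConn' a B C x) a b c := by
  have h : ∀ b, S.connLow a b b x = 0 := fun b ↦ by
    linear_combination (1 / 2) * S.connLow_antisymm a b b x
  have h1 := S.connLow_antisymm a (0, 1) (0, 0) x
  have h2 := S.connLow_antisymm a (1, 0) (0, 0) x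
  have h3 := S.connLow_antisymm a (1, 1) (0, 0) x
  have h4 := S.connLow_antisymm a (1, 0) (0, 1) x
  have h5 := S.connLow_antisymm a (1, 1) (0, 1) x
  have h6 := S.connLow_antisymm a (1, 1) (1, 0) x
  obtain ⟨B, B'⟩ := b
  obtain ⟨C, C'⟩ := c
  simp only [tensorConn, spinConn, spinConn', conn, Fintype.sum_prod_type, Fin.sum_univ_two]
  fin_cases B <;> fin_cases B' <;> fin_cases C <;> fin_cases C' <;>
    simp [gEps, eps, h, h1, h2, h3, h4, h5, h6] <;> ring

lemma spinConn_trace (a : Idx) (x : M) : S.spinConn a 1 1 x = -S.spinConn a 0 0 x := by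
  have h3 := S.connLow_antisymm a (1, 1) (0, 0) x
  have h4 := S.connLow_antisymm a (1, 0) (0, 1) x
  simp only [spinConn, conn, Fintype.sum_prod_type, Fin.sum_univ_two]
  simp [gEps, eps, h3, h4]
  ring

lemma spinConn'_trace (a : Idx) (x : M) : S.spinConn' a 1 1 x = -S.spinConn' a 0 0 x := by
  have h3 := S.connLow_antisymm a (1, 1) (0, 0) x
  have h4 := S.connLow_antisymm a (1, 0) (0, 1) x
  simp only [spinConn', conn, Fintype.sum_prod_type, Fin.sum_univ_two]
  simp [gEps, eps, h3, h4]
  ring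

end SpinStructure
end TwoSpinor
end

noncomputable section

namespace TwoSpinor
namespace SpinStructure

open Set Filter Topology VectorField

variable {M : Type*} [TopologicalSpace M] [ChartedSpace (EuclideanSpace ℝ (Fin 4)) M]

/-! ## The spinor connection over the ring of smooth functions on an open set -/

/-- The extension by zero of a function on `U`. -/
def extendZero {U : Set M} (f : U → ℂ) : M → ℂ := Function.extend Subtype.val f 0

omit [TopologicalSpace M] [ChartedSpace (EuclideanSpace ℝ (Fin 4)) M] in
lemma extendZero_apply {U : Set M} (f : U → ℂ) {x : M} (hx : x ∈ U) :
    extendZero f x = f ⟨x, hx⟩ :=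
  Subtype.val_injective.extend_apply f 0 ⟨x, hx⟩

/-- The smooth complex functions on `U`. -/
def smoothRing (U : Set M) : Subring (U → ℂ) where
  carrier := {f | ContMDiffOn (𝓡 4) 𝓘(ℝ, ℂ) ∞ (extendZero f) U}
  zero_mem' := (contMDiffOn_const (c := (0 : ℂ))).congr fun x hx ↦ by
    rw [extendZero_apply _ hx]; rfl
  one_mem' := (contMDiffOn_const (c := (1 : ℂ))).congr fun x hx ↦ by
    rw [extendZero_apply _ hx]; rfl
  add_mem' {f h} hf hh := (ContMDiffOn.add hf hh).congr fun x hx ↦ by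
    simp only [Pi.add_apply, extendZero_apply _ hx]
  neg_mem' {f} hf := (ContMDiffOn.neg hf).congr fun x hx ↦ by
    simp only [Pi.neg_apply, extendZero_apply _ hx]
  mul_mem' {f h} hf hh := (contMDiffOn_complex_mul hf hh).congr fun x hx ↦ by
    simp only [Pi.mul_apply, extendZero_apply _ hx]

/-- The restriction to `U` of a function that is smooth on `U`. -/
def restrictSmooth {U : Set M} (f : M → ℂ) (hf : ContMDiffOn (𝓡 4) 𝓘(ℝ, ℂ) ∞ f U) :
    smoothRing U :=
  ⟨fun x ↦ f x, hf.congr fun _ hx ↦ extendZero_apply _ hx⟩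

/-- Evaluation at a point of `U`. -/
def evalAt {U : Set M} (x : U) : smoothRing U →+* ℂ :=
  (Pi.evalRingHom (fun _ : U ↦ ℂ) x).comp (smoothRing U).subtype

@[simp]
lemma evalAt_restrictSmooth {U : Set M} (f : M → ℂ) (hf : ContMDiffOn (𝓡 4) 𝓘(ℝ, ℂ) ∞ f U)
    (x : U) : evalAt x (restrictSmooth f hf) = f x := rfl

lemma ext_evalAt {U : Set M} {f h : smoothRing U} (hfh : ∀ x, evalAt x f = evalAt x h) : f = h :=
  Subtype.ext (funext hfh)

variable [IsManifold (𝓡 4) ∞ M] {g : LorentzMetric M} (S : SpinStructure g)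
  {U : Set M} (hU : IsOpen U)

/-- The frame derivative `∂_a` as a derivation of the smooth functions on `U`. -/
def pdDerivation (a : Idx) : Derivation ℤ (smoothRing U) (smoothRing U) :=
  have hd : ∀ (f : smoothRing U) {x : M}, x ∈ U →
      MDifferentiableAt (𝓡 4) 𝓘(ℝ, ℂ) (extendZero f.1) x := fun f x hx ↦
    (ContMDiffOn.contMDiffAt f.2 (hU.mem_nhds hx)).mdifferentiableAt (by simp)
  Derivation.mk'
    (AddMonoidHom.toIntLinearMap
      { toFun := fun f ↦ restrictSmooth (S.pd a (extendZero f.1)) (S.contMDiffOn_pd hU f.2 a)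
        map_zero' := by
          ext x
          have h : extendZero (0 : U → ℂ) =ᶠ[𝓝 x.1] fun _ ↦ (0 : ℂ) := by
            filter_upwards [hU.mem_nhds x.2] with y hy
            rw [extendZero_apply _ hy]; rfl
          refine (S.pd_congr h).trans ?_
          simp [pd, mvfderiv_const]
        map_add' := fun f h ↦ by
          ext x
          refine (S.pd_congr ?_).trans (S.pd_add (hd f x.2) (hd h x.2))
          filter_upwards [hU.mem_nhds x.2] with y hy
          simp only [Pi.add_apply, extendZero_apply _ hy]
          rfl })
    fun f h ↦ by
      ext x
      refine (S.pd_congr ?_).trans ((S.pd_mul (hd f x.2) (hd h x.2)).trans ?_)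
      · filter_upwards [hU.mem_nhds x.2] with y hy
        simp only [Pi.mul_apply, extendZero_apply _ hy]
        rfl
      · rw [extendZero_apply _ x.2, extendZero_apply _ x.2]
        rfl

lemma evalAt_pdDerivation (a : Idx) (f : smoothRing U) (x : U) :
    evalAt x (S.pdDerivation hU a f) = S.pd a (extendZero f.1) x := rfl

lemma evalAt_pdDerivation_restrictSmooth (a : Idx) (f : M → ℂ)
    (hf : ContMDiffOn (𝓡 4) 𝓘(ℝ, ℂ) ∞ f U) (x : U) :
    evalAt x (S.pdDerivation hU a (restrictSmooth f hf)) = S.pd a f x := by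
  refine S.pd_congr ?_
  filter_upwards [hU.mem_nhds x.2] with y hy
  rw [extendZero_apply _ hy]; rfl

lemma contMDiff_spinConn (a : Idx) (B C : Fin 2) :
    ContMDiff (𝓡 4) 𝓘(ℝ, ℂ) ∞ (S.spinConn a B C) :=
  contMDiff_const_mul _ (contMDiff_finsetSum fun _ _ ↦ S.contMDiff_conn _ _ _)

lemma contMDiff_spinConn' (a : Idx) (B C : Fin 2) :
    ContMDiff (𝓡 4) 𝓘(ℝ, ℂ) ∞ (S.spinConn' a B C) :=
  contMDiff_const_mul _ (contMDiff_finsetSum fun _ _ ↦ S.contMDiff_conn _ _ _)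

/-- The spinor connection of a spacetime over the smooth functions on `U`. -/
def toSpinFrame : SpinFrame (smoothRing U) where
  d := S.pdDerivation hU
  Γ a B C := restrictSmooth (S.spinConn a B C) (S.contMDiff_spinConn a B C).contMDiffOn
  Γ' a B C := restrictSmooth (S.spinConn' a B C) (S.contMDiff_spinConn' a B C).contMDiffOn
  trace_eq a := by ext x; exact S.spinConn_trace a x
  trace_eq' a := by ext x; exact S.spinConn'_trace a x
  torsion_eq a b f := by
    refine ext_evalAt fun x ↦ ?_
    have h2 : ∀ a b, evalAt x (S.pdDerivation hU a (S.pdDerivation hU b f)) =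
        S.pd a (S.pd b (extendZero f.1)) x := fun a b ↦
      S.evalAt_pdDerivation_restrictSmooth hU a _ (S.contMDiffOn_pd hU f.2 b) x
    simp only [map_sub, h2, S.pd_comm hU f.2 a b x.2, map_sum, map_mul, map_tensorConn,
      evalAt_pdDerivation, evalAt_restrictSmooth, ← S.conn_sub_conn, ← S.conn_eq_tensorConn]

lemma toSpinFrame_γ (a b c : Idx) : (S.toSpinFrame hU).γ a b c =
    restrictSmooth (S.conn a b c) (S.contMDiff_conn a b c).contMDiffOn := by
  refine ext_evalAt fun x ↦ ?_
  simp only [SpinFrame.γ, map_tensorConn, toSpinFrame, evalAt_restrictSmooth,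
    ← S.conn_eq_tensorConn]

lemma evalAt_riem (a b c d : Idx) (x : U) :
    evalAt x ((S.toSpinFrame hU).riem a b c d) = S.riemann a b c d x := by
  simp only [SpinFrame.riem, toSpinFrame_γ, map_sub, map_add, map_sum, map_mul,
    evalAt_restrictSmooth, S.conn_sub_conn]
  simp only [toSpinFrame, evalAt_pdDerivation_restrictSmooth, riemann]

/-- On a chart domain, the frame derivatives separate complex vector fields. -/
lemma eq_zero_of_sum_mul_pdDerivation (x₀ : M)
    (hU : IsOpen (chartAt (EuclideanSpace ℝ (Fin 4)) x₀).source)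
    (v : Idx → smoothRing (chartAt (EuclideanSpace ℝ (Fin 4)) x₀).source)
    (h : ∀ f, ∑ e, v e * S.pdDerivation hU e f = 0) : v = 0 := by
  have : IsManifold (𝓡 4) 1 M := IsManifold.of_le (n := ∞) (by simp)
  set φ := extChartAt (𝓡 4) x₀
  have hφ : ContMDiffOn (𝓡 4) 𝓘(ℝ, EuclideanSpace ℝ (Fin 4)) ∞ φ
    (chartAt (EuclideanSpace ℝ (Fin 4)) x₀).source := contMDiffOn_extChartAt
  refine funext fun c ↦ ext_evalAt fun x ↦ ?_
  set V : Matrix (Fin 2) (Fin 2) ℂ := fun A A' ↦ evalAt x (v (A, A')) with hV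
  have hsplit : ∀ f : M → ℂ, ∑ e : Idx, V e.1 e.2 * S.pd e f x =
      mvfderiv (𝓡 4) f x (S.solder x (realPart V)) +
        Complex.I * mvfderiv (𝓡 4) f x (S.solder x (imaginaryPart V)) := by
    intro f
    rw [S.mvfderiv_eq_sum_comp, S.mvfderiv_eq_sum_comp, Finset.mul_sum, ← Finset.sum_add_distrib]
    refine Finset.sum_congr rfl fun e _ ↦ ?_
    have h1 : V e.1 e.2 = (realPart V).1 e.1 e.2 + Complex.I * (imaginaryPart V).1 e.1 e.2 := by
      conv_lhs => rw [← realPart_add_I_smul_imaginaryPart V]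
      rfl
    simp only [comp, LinearEquiv.symm_apply_apply, h1]
    ring
  have hcoord : ∀ i : Fin 4, ∀ w : TangentSpace (𝓡 4) x.1,
      mvfderiv (𝓡 4) (fun y ↦ (φ y i : ℂ)) x w =
        ((mvfderiv (𝓡 4) φ x w i : ℝ) : ℂ) := by
    intro i w
    let L : EuclideanSpace ℝ (Fin 4) →L[ℝ] ℂ := Complex.ofRealCLM ∘L (EuclideanSpace.proj i)
    have hd : MDifferentiableAt (𝓡 4) 𝓘(ℝ, EuclideanSpace ℝ (Fin 4)) φ x :=
      (hφ.contMDiffAt (hU.mem_nhds x.2)).mdifferentiableAt (by simp)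
    exact congrArg (fun A : EuclideanSpace ℝ (Fin 4) →L[ℝ] ℂ ↦ A w)
      ((L.hasMFDerivAt (x := φ x)).comp x.1 hd.hasMFDerivAt).mfderiv
  have hinj : ∀ w : TangentSpace (𝓡 4) x.1,
      (∀ i, mvfderiv (𝓡 4) φ x w i = 0) → w = 0 := by
    intro w hw
    have hinv : (mfderiv (𝓡 4) 𝓘(ℝ, EuclideanSpace ℝ (Fin 4)) φ x.1).IsInvertible :=
      isInvertible_mfderiv_extChartAt (by rw [extChartAt_source]; exact x.2)
    have h0 : mfderiv (𝓡 4) 𝓘(ℝ, EuclideanSpace ℝ (Fin 4)) φ x.1 w = 0 := by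
      exact PiLp.ext hw
    have := hinv.inverse_apply_self w
    rw [h0, map_zero] at this
    exact this.symm
  have hzero : ∀ i : Fin 4,
      mvfderiv (𝓡 4) φ x (S.solder x (realPart V)) i = 0 ∧
      mvfderiv (𝓡 4) φ x (S.solder x (imaginaryPart V)) i = 0 := by
    intro i
    let L : EuclideanSpace ℝ (Fin 4) →L[ℝ] ℂ := Complex.ofRealCLM ∘L (EuclideanSpace.proj i)
    have hs : ContMDiffOn (𝓡 4) 𝓘(ℝ, ℂ) ∞ (fun y ↦ (φ y i : ℂ))
      (chartAt (EuclideanSpace ℝ (Fin 4)) x₀).source := L.contDiff.contMDiff.comp_contMDiffOn hφ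
    have h1 := congrArg (evalAt x) (h (restrictSmooth _ hs))
    simp only [map_sum, map_mul, map_zero, evalAt_pdDerivation_restrictSmooth] at h1
    have h2 := (hsplit (fun y ↦ (φ y i : ℂ))).symm.trans h1
    rw [hcoord, hcoord] at h2
    exact ⟨by simpa using congrArg Complex.re h2, by simpa using congrArg Complex.im h2⟩
  have hre : realPart V = 0 := by
    simpa using hinj _ fun i ↦ (hzero i).1
  have him : imaginaryPart V = 0 := by
    simpa using hinj _ fun i ↦ (hzero i).2
  have hV0 : V = 0 := by
    rw [← realPart_add_I_smul_imaginaryPart V, hre, him]; simp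
  exact congrFun (congrFun hV0 c.1) c.2

end SpinStructure
end TwoSpinor
end

noncomputable section

namespace TwoSpinor

/-! ## Symmetries of the curvature spinor and the Weyl scalar `Ψ₁` -/

lemma SpinFrame.riem_swap {R : Type*} [CommRing R] (s : SpinFrame R) (a b c d : Idx) :
    s.riem a b c d = -s.riem b a c d := by
  simp only [SpinFrame.riem, sub_mul, Finset.sum_sub_distrib]
  ring

lemma SpinFrame.curv_swap {R : Type*} [CommRing R] (s : SpinFrame R) (a b : Idx) (C D : Fin 2) :
    s.curv a b C D = -s.curv b a C D := by
  simp only [SpinFrame.curv, sub_mul, Finset.sum_sub_distrib]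
  ring

lemma pair_symm_of_cyclic {ι : Type*} {F : ι → ι → ι → ι → ℂ}
    (h12 : ∀ a b c d, F a b c d = -F b a c d) (h34 : ∀ a b c d, F a b c d = -F a b d c)
    (hcyc : ∀ a b c d, F a b c d + F b c a d + F c a b d = 0) (a b c d : ι) :
    F a b c d = F c d a b := by
  linear_combination (1 / 2) * (hcyc a b c d + hcyc b c d a - hcyc c d a b - hcyc d a b c
    - h34 b c d a - h34 c d b a - h12 d b c a + h34 d a c b + h34 a c d b - h12 a c b d
    + h34 a b d c + h34 b d a c)

/-- A sum over `Fin 4 → Fin 2` as an iterated sum. -/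
lemma sum_fin_four_fun (F : (Fin 4 → Fin 2) → ℂ) :
    ∑ i, F i = ∑ A, ∑ B, ∑ C, ∑ D, F ![A, B, C, D] := by
  have h : ∀ (n : ℕ) (F : (Fin (n + 1) → Fin 2) → ℂ),
      ∑ i, F i = ∑ A, ∑ j : Fin n → Fin 2, F (Matrix.vecCons A j) := by
    intro n F
    rw [← (Fin.consEquiv (fun _ : Fin (n + 1) ↦ Fin 2)).sum_comp, Fintype.sum_prod_type]
    rfl
  simp only [h]
  simp [Matrix.vecEmpty, Subsingleton.elim _ (fun i : Fin 0 ↦ i.elim0)]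

/-- The full contraction of a four-index spinor that is symmetric in its last two indices
and under exchange of its index pairs with `o`, `o`, `o`, `ι` does not depend on the order of the latter. -/
lemma sum_mul_prod_perm {X : (Fin 4 → Fin 2) → ℂ}
    (h23 : ∀ j, X (j ∘ Equiv.swap 2 3) = X j)
    (hpair : ∀ j, X (j ∘ (Equiv.swap 0 2 * Equiv.swap 1 3 : Equiv.Perm (Fin 4))) = X j)
    (o ι : Fin 2 → ℂ) (π : Equiv.Perm (Fin 4)) :
    ∑ j, X j * ∏ k, (if π k = 3 then ι else o) (j k) =
      ∑ j, X j * ∏ k : Fin 4, (if k = 3 then ι else o) (j k) := by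
  have key : ∀ τ : Equiv.Perm (Fin 4), (∀ j, X (j ∘ τ) = X j) → τ (π.symm 3) = 3 →
      ∑ j, X j * ∏ k, (if π k = 3 then ι else o) (j k) =
        ∑ j, X j * ∏ k : Fin 4, (if k = 3 then ι else o) (j k) := by
    intro τ hτ h3
    rw [← (Equiv.arrowCongr τ.symm (Equiv.refl (Fin 2))).sum_comp]
    refine Finset.sum_congr rfl fun j _ ↦ ?_
    have hj : (Equiv.arrowCongr τ.symm (Equiv.refl (Fin 2))) j = j ∘ τ := rfl
    rw [hj, hτ, ← Equiv.prod_comp τ (fun k ↦ (if k = 3 then ι else o) (j k))]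
    congr 1
    refine Finset.prod_congr rfl fun k _ ↦ ?_
    have : π k = 3 ↔ τ k = 3 := by
      rw [← Equiv.eq_symm_apply]
      exact ⟨fun h ↦ h ▸ h3, fun h ↦ τ.injective (h.trans h3.symm)⟩
    simp only [this, Function.comp_apply]
  generalize hp : π.symm 3 = p at key
  fin_cases p
  · refine key (Equiv.swap 2 3 * (Equiv.swap 0 2 * Equiv.swap 1 3)) (fun j ↦ ?_) (by decide)
    exact (hpair (j ∘ Equiv.swap 2 3)).trans (h23 j)
  · exact key _ hpair (by decide)
  · exact key _ h23 (by decide)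
  · exact key 1 (fun j ↦ rfl) (by decide)

namespace SpinStructure

open Set Filter Topology VectorField

variable {M : Type*} [TopologicalSpace M] [ChartedSpace (EuclideanSpace ℝ (Fin 4)) M]
  [IsManifold (𝓡 4) ∞ M] {g : LorentzMetric M} (S : SpinStructure g)

lemma riemann_eq {U : Set M} (hU : IsOpen U) (a b : Idx) (C C' D D' : Fin 2) (x : U) :
    S.riemann a b (C, C') (D, D') x =
      (if C' = D' then evalAt x ((S.toSpinFrame hU).curv a b D C) else 0) +
      (if C = D then evalAt x ((S.toSpinFrame hU).curv' a b D' C') else 0) := by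
  rw [← S.evalAt_riem hU, SpinFrame.riem_eq]
  simp [apply_ite (evalAt x)]

lemma riemannLow_swap_right (a b c d : Idx) (x : M) :
    S.riemannLow a b c d x = -S.riemannLow a b d c x := by
  have ht := congrArg (evalAt (⟨x, mem_univ x⟩ : (univ : Set M)))
    ((S.toSpinFrame isOpen_univ).curv_trace a b)
  have ht' := congrArg (evalAt (⟨x, mem_univ x⟩ : (univ : Set M)))
    ((S.toSpinFrame isOpen_univ).curv'_trace a b)
  have h : ∀ C C' D D', _ := fun C C' D D' ↦
    S.riemann_eq isOpen_univ a b C C' D D' (⟨x, mem_univ x⟩ : (univ : Set M))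
  simp only [map_neg] at ht ht' h
  obtain ⟨C, C'⟩ := c
  obtain ⟨D, D'⟩ := d
  simp only [riemannLow, Fintype.sum_prod_type, Fin.sum_univ_two, h]
  fin_cases C <;> fin_cases C' <;> fin_cases D <;> fin_cases D' <;>
    simp [gEps, eps, ht, ht'] <;> ring

lemma riemannLow_pair_symm (a b c d : Idx) (x : M) :
    S.riemannLow a b c d x = S.riemannLow c d a b x := by
  have hU := (chartAt (EuclideanSpace ℝ (Fin 4)) x).open_source
  have hx := mem_chart_source (EuclideanSpace ℝ (Fin 4)) x
  set y : (chartAt (EuclideanSpace ℝ (Fin 4)) x).source := ⟨x, hx⟩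
  have h : ∀ a b c d, S.riemann a b c d x = _ := fun a b c d ↦ (S.evalAt_riem hU a b c d y).symm
  have hcyc := (S.toSpinFrame hU).riem_cyclic
    fun v hv ↦ S.eq_zero_of_sum_mul_pdDerivation x hU v hv
  refine pair_symm_of_cyclic (F := fun a b c d ↦ S.riemannLow a b c d x) ?_
    (fun a b c d ↦ S.riemannLow_swap_right a b c d x) ?_ a b c d
  · intro a b c d
    simp only [riemannLow, ← Finset.sum_neg_distrib, ← neg_mul]
    refine Finset.sum_congr rfl fun e _ ↦ ?_
    rw [h, h, SpinFrame.riem_swap, map_neg]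
  · intro a b c d
    simp only [riemannLow, ← Finset.sum_add_distrib, ← add_mul, h, ← map_add]
    refine Finset.sum_eq_zero fun e _ ↦ ?_
    rw [hcyc, map_zero, zero_mul]

lemma curvSpinor_pair_symm (A B C D : Fin 2) (x : M) :
    S.curvSpinor A B C D x = S.curvSpinor C D A B x := by
  have h : ∀ A' B' C' D', _ := fun A' B' C' D' ↦
    S.riemannLow_pair_symm (A, A') (B, B') (C, C') (D, D') x
  simp only [curvSpinor, Fin.sum_univ_two]
  simp [eps]
  linear_combination (h 0 1 0 1 - h 0 1 1 0 - h 1 0 0 1 + h 1 0 1 0)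

lemma curvSpinor_swap_right (A B C D : Fin 2) (x : M) :
    S.curvSpinor A B C D x = S.curvSpinor A B D C x := by
  have h : ∀ A' B' C' D', _ := fun A' B' C' D' ↦
    S.riemannLow_swap_right (A, A') (B, B') (C, C') (D, D') x
  simp only [curvSpinor, Fin.sum_univ_two]
  simp [eps]
  linear_combination (h 0 1 0 1 - h 0 1 1 0 - h 1 0 0 1 + h 1 0 1 0)

/-- The curvature spinor in terms of the curvature of the spinor connection. -/
lemma curvSpinor_eq {U : Set M} (hU : IsOpen U) (A B C D : Fin 2) (x : U) :
    S.curvSpinor A B C D x = (1 / 2) * ∑ A', ∑ B', eps A' B' *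
      ∑ E, evalAt x ((S.toSpinFrame hU).curv (A, A') (B, B') E C) * eps E D := by
  have ht' := fun a b ↦ congrArg (evalAt x) ((S.toSpinFrame hU).curv'_trace a b)
  simp only [map_neg] at ht'
  simp only [curvSpinor, riemannLow, Fintype.sum_prod_type, Fin.sum_univ_two,
    S.riemann_eq hU _ _ _ _ _ _ x]
  fin_cases C <;> fin_cases D <;> simp [gEps, eps, ht'] <;> ring

/-- `Ψ₁` is the contraction of the curvature spinor with `o`, `o`, `o`, `ι` in any order. -/
lemma Psi1_eq_sum (D : SpinDyad M) (x : M) (π : Equiv.Perm (Fin 4)) :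
    S.Psi1 D x = ∑ j : Fin 4 → Fin 2, S.curvSpinor (j 0) (j 1) (j 2) (j 3) x *
      ∏ k, (if π k = 3 then D.ι x else D.o x) (j k) := by
  have key := sum_mul_prod_perm (X := fun j ↦ S.curvSpinor (j 0) (j 1) (j 2) (j 3) x)
    (fun j ↦ S.curvSpinor_swap_right _ _ _ _ x)
    (fun j ↦ S.curvSpinor_pair_symm _ _ _ _ x) (D.o x) (D.ι x)
  rw [key π]
  have hπ : ∀ π : Equiv.Perm (Fin 4), ∑ i : Fin 4 → Fin 2,
      S.curvSpinor (i (π 0)) (i (π 1)) (i (π 2)) (i (π 3)) x *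
        ∏ k : Fin 4, (if k = 3 then D.ι x else D.o x) (i k) =
      ∑ j : Fin 4 → Fin 2, S.curvSpinor (j 0) (j 1) (j 2) (j 3) x *
        ∏ k : Fin 4, (if k = 3 then D.ι x else D.o x) (j k) := by
    intro π
    refine Eq.trans ?_ (key π)
    refine Eq.trans ?_ (Equiv.sum_comp (Equiv.arrowCongr π.symm (Equiv.refl (Fin 2)))
      fun j : Fin 4 → Fin 2 ↦ S.curvSpinor (j 0) (j 1) (j 2) (j 3) x *
        ∏ k, (if π k = 3 then D.ι x else D.o x) (j k))
    refine Finset.sum_congr rfl fun i _ ↦ ?_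
    have hi : (Equiv.arrowCongr π.symm (Equiv.refl (Fin 2))) i = i ∘ π := rfl
    rw [hi, ← Equiv.prod_comp π fun k ↦ (if k = 3 then D.ι x else D.o x) (i k)]
    simp only [Function.comp_apply]
  have h1 : S.Psi1 D x = (1 / 24) * ∑ π : Equiv.Perm (Fin 4), ∑ i : Fin 4 → Fin 2,
      S.curvSpinor (i (π 0)) (i (π 1)) (i (π 2)) (i (π 3)) x *
        ∏ k : Fin 4, (if k = 3 then D.ι x else D.o x) (i k) := by
    rw [Finset.sum_comm, Finset.mul_sum]
    simp only [Psi1, weylSpinor, ← Finset.sum_mul, ← mul_assoc]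
    refine Finset.sum_congr rfl fun i _ ↦ ?_
    simp [Fin.prod_univ_four]
    ring
  rw [h1, Finset.sum_congr rfl fun π _ ↦ hπ π, Finset.sum_const, Finset.card_univ,
    Fintype.card_perm, Fintype.card_fin]
  norm_num [Nat.factorial]
  ring

end SpinStructure
end TwoSpinor
end

noncomputable section

namespace TwoSpinor

open Set

variable {M : Type*} [TopologicalSpace M] [ChartedSpace (EuclideanSpace ℝ (Fin 4)) M]

/-! ## The adapted spin frame -/

namespace SpinDyad

variable (D : SpinDyad M) (U : Set M)

/-- The components of the dyad over the smooth functions on `U`: the columns are `o` and `ι`. -/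
def frame (B A : Fin 2) : SpinStructure.smoothRing U :=
  ![SpinStructure.restrictSmooth (fun y ↦ D.o y B)
      (contMDiff_pi_space.1 D.contMDiff_o B).contMDiffOn,
    SpinStructure.restrictSmooth (fun y ↦ D.ι y B)
      (contMDiff_pi_space.1 D.contMDiff_ι B).contMDiffOn] A

variable {U}

@[simp]
lemma evalAt_frame_zero (B : Fin 2) (x : U) :
    SpinStructure.evalAt x (D.frame U B 0) = D.o x B := rfl

@[simp]
lemma evalAt_frame_one (B : Fin 2) (x : U) :
    SpinStructure.evalAt x (D.frame U B 1) = D.ι x B := rfl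

lemma det_apply (x : M) : D.o x 0 * D.ι x 1 - D.ι x 0 * D.o x 1 = 1 := by
  have h := D.normalized x
  simp [lower, eps, Fin.sum_univ_two] at h
  linear_combination h

lemma det_frame : D.frame U 0 0 * D.frame U 1 1 - D.frame U 0 1 * D.frame U 1 0 = 1 :=
  SpinStructure.ext_evalAt fun x ↦ by simpa using D.det_apply x

end SpinDyad

namespace SpinStructure

variable [IsManifold (𝓡 4) ∞ M] {g : LorentzMetric M} (S : SpinStructure g) (D : SpinDyad M)
  {U : Set M} (hU : IsOpen U)

/-- The spinor connection in the frame given by the dyad. -/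
def dyadFrame : SpinFrame (smoothRing U) := (S.toSpinFrame hU).rotate D.det_frame

lemma dyadFrame_curv (a b : Idx) (E C : Fin 2) (x : U) :
    ∑ F, evalAt x (D.frame U E F) * evalAt x ((S.dyadFrame D hU).curv a b F C) =
      ∑ A, ∑ B, evalAt x (D.frame U A a.1) * evalAt x (D.frame U B b.1) *
        ∑ F, evalAt x ((S.toSpinFrame hU).curv (A, a.2) (B, b.2) E F) *
          evalAt x (D.frame U F C) := by
  have h := congrArg (evalAt x)
    ((S.toSpinFrame hU).sum_mul_rotate_curv D.det_frame a b E C)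
  simp only [map_sum, map_mul] at h
  exact h

lemma Psi1_eq_curv_expansion (x : U) :
    S.Psi1 D x = evalAt x ((S.dyadFrame D hU).curv (0, 0) (0, 1) 0 0) := by
  have hc : ∀ A' B' E : Fin 2, _ := fun A' B' E ↦ S.dyadFrame_curv D hU (0, A') (0, B') E 0 x
  have hsw := congrArg (evalAt x) ((S.dyadFrame D hU).curv_swap (0, 1) (0, 0) 0 0)
  have hdet := D.det_apply x.1
  rw [S.Psi1_eq_sum D x.1 1, sum_fin_four_fun]
  simp only [S.curvSpinor_eq hU _ _ _ _ x, Fin.prod_univ_four, Fin.sum_univ_two] at hc ⊢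
  simp only [SpinDyad.evalAt_frame_zero, SpinDyad.evalAt_frame_one, map_neg] at hc hsw
  simp [eps]
  linear_combination
    (-1 / 2) * (D.ι x 1 * hc 0 1 0 - D.ι x 0 * hc 0 1 1 - D.ι x 1 * hc 1 0 0 + D.ι x 0 * hc 1 0 1)
    + (1 / 2) * (evalAt x ((S.dyadFrame D hU).curv (0, 0) (0, 1) 0 0)
      - evalAt x ((S.dyadFrame D hU).curv (0, 1) (0, 0) 0 0)) * hdet - (1 / 2) * hsw

lemma Psi1_eq_curv_twist (x : U) :
    -2 * S.Psi1 D x = evalAt x ((S.dyadFrame D hU).curv (0, 0) (1, 1) 1 0) -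
      evalAt x ((S.dyadFrame D hU).curv (0, 1) (1, 0) 1 0) := by
  have hc : ∀ A' B' E : Fin 2, _ := fun A' B' E ↦ S.dyadFrame_curv D hU (0, A') (1, B') E 0 x
  have hdet := D.det_apply x.1
  rw [S.Psi1_eq_sum D x.1 (Equiv.swap 1 3), sum_fin_four_fun]
  simp only [S.curvSpinor_eq hU _ _ _ _ x, Fin.prod_univ_four, Fin.sum_univ_two] at hc ⊢
  simp only [SpinDyad.evalAt_frame_zero, SpinDyad.evalAt_frame_one] at hc
  simp [eps, Equiv.swap_apply_def]
  linear_combination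
    D.o x 1 * hc 0 1 0 - D.o x 0 * hc 0 1 1 - D.o x 1 * hc 1 0 0 + D.o x 0 * hc 1 0 1
    + (evalAt x ((S.dyadFrame D hU).curv (0, 0) (1, 1) 1 0)
      - evalAt x ((S.dyadFrame D hU).curv (0, 1) (1, 0) 1 0)) * hdet

lemma evalAt_nab {K : M → Fin 2 → Fin 2 → ℂ}
    (hK : ∀ A B, ContMDiffOn (𝓡 4) 𝓘(ℝ, ℂ) ∞ (fun x ↦ K x A B) U) (a : Idx) (B C : Fin 2) (x : U) :
    evalAt x ((S.toSpinFrame hU).nab a (fun A B ↦ restrictSmooth _ (hK A B)) B C) =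
      S.nabla2 a K B C x := by
  simp only [SpinFrame.nab, toSpinFrame, map_sub, map_sum, map_mul, evalAt_restrictSmooth,
    evalAt_pdDerivation_restrictSmooth, nabla2]

lemma dyadFrame_shear (h : S.IsShearFreeRay D.o) (A' : Fin 2) :
    (S.dyadFrame D hU).Γ (0, A') 1 0 = 0 := by
  have hl : ∀ B, ContMDiffOn (𝓡 4) 𝓘(ℝ, ℂ) ∞ (fun y ↦ lower (D.o y) B) U := fun B ↦ by
    simp only [lower, mul_comm (D.o _ _)]
    exact (contMDiff_finsetSum fun A _ ↦
      contMDiff_const_mul _ (contMDiff_pi_space.1 D.contMDiff_o A)).contMDiffOn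
  refine (S.toSpinFrame hU).rotate_shear D.det_frame (l := fun B ↦ restrictSmooth _ (hl B)) ?_ ?_ ?_
  · exact ext_evalAt fun x ↦ by simp [lower, eps]
  · exact ext_evalAt fun x ↦ by simp [lower, eps]
  · refine ext_evalAt fun x ↦ ?_
    have hx := h x A'
    simp only [nabla1] at hx
    simpa only [map_sum, map_mul, map_sub, map_zero, toSpinFrame, evalAt_restrictSmooth,
      evalAt_pdDerivation_restrictSmooth, SpinDyad.evalAt_frame_zero] using hx

end SpinStructure
end TwoSpinor
end

open TwoSpinor
theorem projKS_trivial_of_Psi1_ne_zero {M : Type*} [TopologicalSpace M]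
    [ChartedSpace (EuclideanSpace ℝ (Fin 4)) M] [IsManifold (𝓡 4) ∞ M]
    (g : LorentzMetric M) (S : SpinStructure g) (D : SpinDyad M)
    (hSFR : S.IsShearFreeRay D.o)
    (hPsi1 : ∀ x, S.Psi1 D x ≠ 0)
    (K : M → Fin 2 → Fin 2 → ℂ)
    (hK_smooth : ContMDiff (𝓡 4) 𝓘(ℝ, Fin 2 → Fin 2 → ℂ) ∞ K)
    (hK_symm : ∀ x A B, K x A B = K x B A) :
    S.ProjKillingSpinorEq D.o K ↔ K = 0 := by
  constructor
  · intro hK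
    funext x₀ A B
    have hU := (chartAt (EuclideanSpace ℝ (Fin 4)) x₀).open_source
    set U := (chartAt (EuclideanSpace ℝ (Fin 4)) x₀).source
    have hx₀ : x₀ ∈ U := mem_chart_source _ x₀
    have hKs : ∀ A B, ContMDiffOn (𝓡 4) 𝓘(ℝ, ℂ) ∞ (fun x ↦ K x A B) U := fun A B ↦
      (contMDiff_pi_space.1 (contMDiff_pi_space.1 hK_smooth A) B).contMDiffOn
    set KR : Fin 2 → Fin 2 → SpinStructure.smoothRing U :=
      fun A B ↦ SpinStructure.restrictSmooth _ (hKs A B) with hKR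
    have hsymm : ∀ A B, KR A B = KR B A := fun A B ↦
      SpinStructure.ext_evalAt fun x ↦ hK_symm x A B
    have hzero : ∀ A B, SpinFrame.rotK (D.frame U) KR A B = 0 := by
      refine (S.dyadFrame D hU).eq_zero_of_symNab_eq_zero (fun k hk ↦ ?_)
        (S.dyadFrame_shear D hU hSFR) ?_ (fun k hk ↦ ?_) (SpinFrame.rotK_symm hsymm)
        fun A' B C ↦ (S.toSpinFrame hU).rotate_symNab_eq_zero D.det_frame (fun B C ↦ ?_) B C
      · refine SpinStructure.ext_evalAt fun x ↦ ?_
        simpa [map_ofNat] using congrArg (SpinStructure.evalAt x) hk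
      · refine SpinStructure.ext_evalAt fun x ↦ ?_
        rw [map_sub, ← S.Psi1_eq_curv_twist D hU, map_mul, ← S.Psi1_eq_curv_expansion D hU,
          map_neg, map_ofNat]
      · refine SpinStructure.ext_evalAt fun x ↦ ?_
        have h := congrArg (SpinStructure.evalAt x) hk
        rw [map_mul, ← S.Psi1_eq_curv_expansion D hU, map_zero] at h
        rw [map_zero]
        exact (mul_eq_zero.1 h).resolve_left (hPsi1 x)
      · refine SpinStructure.ext_evalAt fun x ↦ ?_
        have h := hK x A' B C
        simp only [sym3, Fin.sum_univ_two] at h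
        simp only [SpinFrame.symNab, Fin.sum_univ_two, map_add, map_mul, map_zero, hKR,
          S.evalAt_nab hU hKs, SpinDyad.evalAt_frame_zero]
        linear_combination 6 * h
    exact congrArg (SpinStructure.evalAt ⟨x₀, hx₀⟩)
      (SpinFrame.eq_zero_of_rotK D.det_frame hzero A B)
  · rintro rfl x A' B C
    have h0 : ∀ a : Idx, S.pd a (fun _ ↦ (0 : ℂ)) x = 0 := fun a ↦ by
      simp [SpinStructure.pd, mvfderiv_const]
    simp [SpinStructure.nabla2, sym3, h0]
end
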